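/- arXiv:2112.01910 — 14 statements merged into one kernel-verified Lean document; each statement's English description precedes it below -/
import Mathlib

section
/- Let G be a twin-free graph of order n with no isolated vertices. Then γ⃗_LD(G) ≤ n/2. -/
open SimpleGraph

/-- `S` is a locating-dominating set of the undirected graph `G`. -/
def IsLDSet {V : Type*} (G : SimpleGraph V) (S : Set V) : Prop :=
  (∀ u ∉ S, (G.neighborSet u ∩ S).Nonempty) ∧
    ∀ u ∉ S, ∀ v ∉ S, u ≠ v → G.neighborSet u ∩ S ≠ G.neighborSet v ∩ S

/-- The location-domination number of the undirected graph `G`. -/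
noncomputable def gammaLD {V : Type*} (G : SimpleGraph V) : ℕ :=
  sInf {n | ∃ S : Set V, IsLDSet G S ∧ S.ncard = n}

/-- `D` is an orientation of `G`: every arc of `D` is an edge of `G`, and every
edge of `G` is given exactly one of its two possible directions. -/
def IsOrientation {V : Type*} (G : SimpleGraph V) (D : V → V → Prop) : Prop :=
  (∀ u v, D u v → G.Adj u v) ∧ ∀ u v, G.Adj u v → (D u v ↔ ¬ D v u)

/-- `S` is a locating-dominating set of the directed graph `D`
(arcs given as a relation: `D w u` means there is an arc from `w` to `u`). -/
def IsDirLDSet {V : Type*} (D : V → V → Prop) (S : Set V) : Prop :=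
  (∀ u ∉ S, ({w | D w u} ∩ S).Nonempty) ∧
    ∀ u ∉ S, ∀ v ∉ S, u ≠ v → {w | D w u} ∩ S ≠ {w | D w v} ∩ S

/-- The location-domination number of a directed graph. -/
noncomputable def gammaLDdir {V : Type*} (D : V → V → Prop) : ℕ :=
  sInf {n | ∃ S : Set V, IsDirLDSet D S ∧ S.ncard = n}

/-- The lower directed location-domination number of `G`:
minimum of `gammaLDdir D` over all orientations `D` of `G`. -/
noncomputable def lowerDirLD {V : Type*} (G : SimpleGraph V) : ℕ :=
  sInf {n | ∃ D : V → V → Prop, IsOrientation G D ∧ gammaLDdir D = n}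

/-- The upper directed location-domination number of `G`:
maximum of `gammaLDdir D` over all orientations `D` of `G`. -/
noncomputable def upperDirLD {V : Type*} (G : SimpleGraph V) : ℕ :=
  sSup {n | ∃ D : V → V → Prop, IsOrientation G D ∧ gammaLDdir D = n}

/-- Two vertices are twins if they have the same open or closed neighbourhood. -/
def AreTwins {V : Type*} (G : SimpleGraph V) (u v : V) : Prop :=
  G.neighborSet u = G.neighborSet v ∨
    G.neighborSet u ∪ {u} = G.neighborSet v ∪ {v}

/-- Assigning to every vertex outside `S` its own nonempty set of neighbours in `S`
yields an orientation in which `S` is locating-dominating. -/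
theorem lowerDirLD_le_card {V : Type*} [Fintype V] (G : SimpleGraph V) (S : Finset V)
    (f : V → Finset V) (hne : ∀ u ∉ S, (f u).Nonempty) (hS : ∀ u ∉ S, ∀ w ∈ f u, w ∈ S)
    (hadj : ∀ u ∉ S, ∀ w ∈ f u, G.Adj u w)
    (hinj : ∀ u ∉ S, ∀ v ∉ S, f u = f v → u = v) :
    lowerDirLD G ≤ S.card := by
  classical
  let e := Fintype.equivFin V
  let D : V → V → Prop := fun u v =>
    G.Adj u v ∧ ((u ∈ S ∧ v ∉ S ∧ u ∈ f v) ∨ (u ∉ S ∧ v ∈ S ∧ v ∉ f u) ∨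
      ((u ∈ S ↔ v ∈ S) ∧ e u < e v))
  have hD : IsOrientation G D := by
    refine ⟨fun u v h => h.1, fun u v huv => ?_⟩
    have hne' : e u ≠ e v := fun h => huv.ne (e.injective h)
    have hlt : e u < e v ↔ ¬ e v < e u := ⟨fun h => h.asymm, fun h => by
      rcases lt_or_gt_of_ne hne' with h' | h'
      · exact h'
      · exact absurd h' h⟩
    simp only [D, huv, huv.symm, true_and, hlt]
    by_cases hu : u ∈ S <;> by_cases hv : v ∈ S <;> simp [hu, hv]
  have hin : ∀ u ∉ S, {w | D w u} ∩ (S : Set V) = (f u : Set V) := by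
    intro u hu
    ext w
    simp only [D, Set.mem_inter_iff, Set.mem_ofPred_eq, Finset.mem_coe]
    constructor
    · rintro ⟨⟨-, h | h | h⟩, hw⟩
      · exact h.2.2
      · exact absurd hw h.1
      · exact absurd (h.1.1 hw) hu
    · intro hw
      have := hS u hu w hw
      exact ⟨⟨(hadj u hu w hw).symm, Or.inl ⟨this, hu, hw⟩⟩, this⟩
  have hLD : IsDirLDSet D (S : Set V) := by
    refine ⟨fun u hu => ?_, fun u hu v hv huv h => huv ?_⟩
    · rw [hin u hu]
      exact hne u hu
    · rw [hin u hu, hin v hv] at h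
      exact hinj u hu v hv (Finset.coe_injective h)
  have hG : lowerDirLD G ≤ gammaLDdir D := Nat.sInf_le ⟨D, hD, rfl⟩
  exact hG.trans (Nat.sInf_le ⟨S, hLD, Set.ncard_coe_finset S⟩)

/-- `P` is a family of pairwise disjoint sets of odd size, each of them a union of
connected components of `G - A`. -/
structure IsOddFamily {V : Type*} (G : SimpleGraph V) (A : Finset V)
    (P : Finset (Finset V)) : Prop where
  eq_of_mem : ∀ X ∈ P, ∀ Y ∈ P, ∀ x, x ∈ X → x ∈ Y → X = Y
  odd_card : ∀ X ∈ P, Odd X.card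
  notMem : ∀ X ∈ P, ∀ x ∈ X, x ∉ A
  closed : ∀ X ∈ P, ∀ x ∈ X, ∀ y, G.Adj x y → y ∉ A → y ∈ X

/-- A form of Tutte's theorem for graphs of even order, with the parity gain made explicit. -/
theorem exists_isOddFamily_of_no_perfectMatching {V : Type*} [Fintype V] [DecidableEq V]
    (G : SimpleGraph V) (heven : Even (Fintype.card V))
    (hM : ¬ ∃ M : G.Subgraph, M.IsPerfectMatching) :
    ∃ (T : Finset V) (Q : Finset (Finset V)), IsOddFamily G T Q ∧ T.card + 2 ≤ Q.card := by
  classical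
  rw [SimpleGraph.tutte] at hM
  push Not at hM
  obtain ⟨T, hT⟩ := hM
  unfold SimpleGraph.IsTutteViolator at hT
  set H := ((⊤ : G.Subgraph).deleteVerts T) with hH
  have hpar := H.coe.odd_ncard_oddComponents
  have hcard : Nat.card H.verts + T.ncard = Fintype.card V := by
    rw [Nat.card_coe_set_eq, ← Nat.card_eq_fintype_card, add_comm, ← Set.ncard_add_ncard_compl T]
    congr 2
    ext x
    simp [hH]
  have hgain : T.ncard + 2 ≤ H.coe.oddComponents.ncard := by
    grind
  let φ : H.coe.ConnectedComponent → Finset V := fun c => (Subtype.val '' c.supp).toFinset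
  have hφmem : ∀ c (x : V), x ∈ φ c ↔ ∃ h : x ∈ H.verts, (⟨x, h⟩ : H.verts) ∈ c.supp := by
    intro c x
    simp [φ]
  have hφcard : ∀ c, (φ c).card = c.supp.ncard := by
    intro c
    rw [← Set.ncard_eq_toFinset_card', Set.ncard_image_of_injective _ Subtype.val_injective]
  have hφeq : ∀ c d x, x ∈ φ c → x ∈ φ d → c = d := by
    intro c d x hc hd
    obtain ⟨h, hc⟩ := (hφmem c x).1 hc
    obtain ⟨_, hd⟩ := (hφmem d x).1 hd
    exact SimpleGraph.ConnectedComponent.eq_of_common_vertex hc hd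
  have hφinj : Function.Injective φ := by
    intro c d hcd
    obtain ⟨x, hx⟩ := c.nonempty_supp
    have : x.1 ∈ φ c := (hφmem c x).2 ⟨x.2, hx⟩
    exact hφeq c d x this (hcd ▸ this)
  have hverts : ∀ x, x ∈ H.verts ↔ x ∉ T := by
    intro x
    simp [hH]
  refine ⟨T.toFinset, H.coe.oddComponents.toFinset.image φ, ⟨?_, ?_, ?_, ?_⟩, ?_⟩
  · simp only [Finset.mem_image]
    rintro _ ⟨c, -, rfl⟩ _ ⟨d, -, rfl⟩ x hc hd
    rw [hφeq c d x hc hd]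
  · simp only [Finset.mem_image, Set.mem_toFinset]
    rintro _ ⟨c, hc, rfl⟩
    rw [hφcard]
    exact hc
  · simp only [Finset.mem_image]
    rintro _ ⟨c, -, rfl⟩ x hx
    obtain ⟨h, -⟩ := (hφmem c x).1 hx
    simpa using (hverts x).1 h
  · simp only [Finset.mem_image]
    rintro _ ⟨c, -, rfl⟩ x hx y hxy hy
    obtain ⟨h, hc⟩ := (hφmem c x).1 hx
    have hy' : y ∈ H.verts := (hverts y).2 (by simpa using hy)
    refine (hφmem c y).2 ⟨hy', ?_⟩
    refine c.mem_supp_of_adj_mem_supp hc ?_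
    have h1 := (hverts x).1 h
    have h2 := (hverts y).1 hy'
    simp [hH, hxy, h1, h2]
  · rw [Finset.card_image_of_injective _ hφinj, ← Set.ncard_eq_toFinset_card',
      ← Set.ncard_eq_toFinset_card']
    exact hgain

/-- The version of `exists_isOddFamily_of_no_perfectMatching` for the subgraph induced on `Y`, with
perfect matchings given by involutions. -/
theorem exists_isOddFamily_of_no_involution {V : Type*} [Fintype V] [DecidableEq V]
    (G : SimpleGraph V) (Y : Finset V) (heven : Even Y.card)
    (hM : ¬ ∃ m : V → V, ∀ x ∈ Y, m x ∈ Y ∧ m (m x) = x ∧ G.Adj x (m x)) :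
    ∃ (T : Finset V) (Q : Finset (Finset V)), T ⊆ Y ∧ T.card + 2 ≤ Q.card ∧
      (∀ X ∈ Q, X ⊆ Y) ∧
      (∀ X ∈ Q, ∀ X' ∈ Q, ∀ x, x ∈ X → x ∈ X' → X = X') ∧ (∀ X ∈ Q, Odd X.card) ∧
      (∀ X ∈ Q, ∀ x ∈ X, x ∉ T) ∧
      (∀ X ∈ Q, ∀ x ∈ X, ∀ y ∈ Y, G.Adj x y → y ∉ T → y ∈ X) := by
  classical
  let H : SimpleGraph {x // x ∈ Y} := G.comap Subtype.val
  have hH : ¬ ∃ M : H.Subgraph, M.IsPerfectMatching := by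
    rintro ⟨M, hP⟩
    rw [SimpleGraph.Subgraph.isPerfectMatching_iff] at hP
    choose m hm huniq using hP
    refine hM ⟨fun x => if h : x ∈ Y then (m ⟨x, h⟩).1 else x, fun x hx => ?_⟩
    have hinv : m (m ⟨x, hx⟩) = ⟨x, hx⟩ := (huniq _ _ (hm ⟨x, hx⟩).symm).symm
    simp only [hx, dite_true, Subtype.coe_eta, hinv]
    refine ⟨(m ⟨x, hx⟩).2, by simp, ?_⟩
    exact (hm ⟨x, hx⟩).adj_sub
  obtain ⟨T, Q, hQ, hcard⟩ :=
    exists_isOddFamily_of_no_perfectMatching H (by simpa using heven) hH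
  let ι : {x // x ∈ Y} ↪ V := Function.Embedding.subtype _
  have hι : ∀ (Z : Finset {x // x ∈ Y}) (x : V), x ∈ Z.map ι ↔ ∃ h : x ∈ Y, ⟨x, h⟩ ∈ Z := by
    intro Z x
    simp [ι]
  refine ⟨T.map ι, Q.map (Finset.mapEmbedding ι).toEmbedding, ?_, by simpa using hcard,
    ?_, ?_, ?_, ?_, ?_⟩
  · intro x hx
    exact ((hι _ _).1 hx).1
  all_goals
    simp only [Finset.mem_map, RelEmbedding.coe_toEmbedding, Finset.mapEmbedding_apply]
  · rintro _ ⟨X, -, rfl⟩ x hx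
    exact ((hι _ _).1 hx).1
  · rintro _ ⟨X, hX, rfl⟩ _ ⟨X', hX', rfl⟩ x hx hx'
    obtain ⟨a, ha, rfl⟩ := Finset.mem_map.1 hx
    obtain ⟨b, hb, hab⟩ := Finset.mem_map.1 hx'
    obtain rfl := ι.injective hab
    rw [hQ.eq_of_mem X hX X' hX' _ ha hb]
  · rintro _ ⟨X, hX, rfl⟩
    rw [Finset.card_map]
    exact hQ.odd_card X hX
  · rintro _ ⟨X, hX, rfl⟩ x hx hxT
    obtain ⟨a, ha, rfl⟩ := Finset.mem_map.1 hx
    obtain ⟨b, hb, hab⟩ := hxT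
    obtain rfl := ι.injective hab
    exact hQ.notMem X hX _ ha hb
  · rintro _ ⟨X, hX, rfl⟩ x hx y hy hadj hyT
    obtain ⟨a, ha, rfl⟩ := Finset.mem_map.1 hx
    exact (hι _ _).2 ⟨hy, hQ.closed X hX a ha ⟨y, hy⟩ hadj fun h => hyT ⟨_, h, rfl⟩⟩

/-- A Gallai–Edmonds type decomposition: `G - A` splits into at least `|A|` odd parts without
edges between them, each of which has a perfect matching after deletion of any of its vertices. -/
theorem exists_isOddFamily_factorCritical {V : Type*} [Fintype V] [DecidableEq V]
    (G : SimpleGraph V) :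
    ∃ (A : Finset V) (P : Finset (Finset V)), IsOddFamily G A P ∧ A.card ≤ P.card ∧
      (∀ x ∉ A, ∃ X ∈ P, x ∈ X) ∧
      ∀ X ∈ P, ∀ v ∈ X, ∃ m : V → V, ∀ x ∈ X.erase v,
        m x ∈ X.erase v ∧ m (m x) = x ∧ G.Adj x (m x) := by
  classical
  let F : Finset (Finset V × Finset (Finset V)) :=
    {p | IsOddFamily G p.1 p.2 ∧ p.1.card ≤ p.2.card}
  have hF : F.Nonempty := ⟨(∅, ∅), by
    simp only [F, Finset.mem_filter, Finset.mem_univ, true_and]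
    exact ⟨⟨by simp, by simp, by simp, by simp⟩, by simp⟩⟩
  obtain ⟨⟨A, P⟩, hAP, hmax⟩ := Finset.exists_max_image F (fun p => p.2.card) hF
  simp only [F, Finset.mem_filter, Finset.mem_univ, true_and, Prod.forall] at hAP hmax
  obtain ⟨hP, hle⟩ := hAP
  have hcover : ∀ x ∉ A, ∃ X ∈ P, x ∈ X := by
    by_contra! hcon
    obtain ⟨r, hrA, hr⟩ := hcon
    let R : Finset V := {x | x ∉ A ∧ ∀ X ∈ P, x ∉ X}
    have hR : ∀ x, x ∈ R ↔ x ∉ A ∧ ∀ X ∈ P, x ∉ X := by simp [R]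
    have hRclosed : ∀ x ∈ R, ∀ y, G.Adj x y → y ∉ A → y ∈ R := by
      intro x hx y hxy hy
      refine (hR y).2 ⟨hy, fun X hX hyX => ?_⟩
      exact ((hR x).1 hx).2 X hX (hP.closed X hX y hyX x hxy.symm ((hR x).1 hx).1)
    rcases Nat.even_or_odd R.card with hev | hodd
    · have hrR : r ∈ R := (hR r).2 ⟨hrA, hr⟩
      have hpos : 0 < R.card := Finset.card_pos.2 ⟨r, hrR⟩
      have hR'odd : Odd (R.erase r).card := by
        rw [Finset.card_erase_of_mem hrR]
        exact Nat.Even.sub_odd hpos hev odd_one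
      have hnot : R.erase r ∉ P := fun h => by
        obtain ⟨x, hx⟩ := Finset.card_pos.1 hR'odd.pos
        exact ((hR x).1 (Finset.mem_of_mem_erase hx)).2 _ h hx
      have := hmax (insert r A) (insert (R.erase r) P) ⟨⟨?_, ?_, ?_, ?_⟩, ?_⟩
      · rw [Finset.card_insert_of_notMem hnot] at this
        omega
      · have := hP.eq_of_mem
        grind
      · have := hP.odd_card
        grind
      · have := hP.notMem
        grind
      · have := hP.closed
        grind
      · rw [Finset.card_insert_of_notMem hnot, Finset.card_insert_of_notMem hrA]
        omega
    · have hnot : R ∉ P := fun h => by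
        obtain ⟨x, hx⟩ := Finset.card_pos.1 hodd.pos
        exact ((hR x).1 hx).2 _ h hx
      have := hmax A (insert R P) ⟨⟨?_, ?_, ?_, ?_⟩, ?_⟩
      · rw [Finset.card_insert_of_notMem hnot] at this
        omega
      · have := hP.eq_of_mem
        grind
      · have := hP.odd_card
        grind
      · have := hP.notMem
        grind
      · have := hP.closed
        grind
      · rw [Finset.card_insert_of_notMem hnot]
        omega
  refine ⟨A, P, hP, hle, hcover, fun X hX v hv => ?_⟩
  by_contra hcon
  have hev : Even (X.erase v).card := by
    rw [Finset.card_erase_of_mem hv]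
    exact Nat.Odd.sub_odd (hP.odd_card X hX) odd_one
  obtain ⟨T, Q, hTY, hcard, hQY, hQeq, hQodd, hQT, hQcl⟩ :=
    exists_isOddFamily_of_no_involution G (X.erase v) hev hcon
  have hsub : ∀ Z ∈ Q, ∀ x ∈ Z, x ∈ X ∧ x ≠ v := fun Z hZ x hx =>
    ⟨Finset.mem_of_mem_erase (hQY Z hZ hx), Finset.ne_of_mem_erase (hQY Z hZ hx)⟩
  have hTX : ∀ x ∈ T, x ∈ X ∧ x ≠ v := fun x hx =>
    ⟨Finset.mem_of_mem_erase (hTY hx), Finset.ne_of_mem_erase (hTY hx)⟩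
  have hdisj : Disjoint (P.erase X) Q := by
    rw [Finset.disjoint_left]
    intro Z hZ hZQ
    obtain ⟨x, hx⟩ := Finset.card_pos.1 (hQodd Z hZQ).pos
    exact Finset.ne_of_mem_erase hZ
      (hP.eq_of_mem Z (Finset.mem_of_mem_erase hZ) X hX x hx (hsub Z hZQ x hx).1)
  have hPpos : 0 < P.card := Finset.card_pos.2 ⟨X, hX⟩
  have hnew : (P.erase X ∪ Q).card = P.card - 1 + Q.card := by
    rw [Finset.card_union_of_disjoint hdisj, Finset.card_erase_of_mem hX]
  have hA' : (A ∪ insert v T).card ≤ A.card + (T.card + 1) :=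
    (Finset.card_union_le _ _).trans (Nat.add_le_add_left (Finset.card_insert_le _ _) _)
  have hPeq := hP.eq_of_mem
  have hPodd := hP.odd_card
  have hPnot := hP.notMem
  have hPcl := hP.closed
  have := hmax (A ∪ insert v T) (P.erase X ∪ Q) ⟨⟨?_, ?_, ?_, ?_⟩, by omega⟩
  · omega
  · intro Z hZ Z' hZ' x hx hx'
    simp only [Finset.mem_union, Finset.mem_erase] at hZ hZ'
    grind
  · grind
  · intro Z hZ x hx
    simp only [Finset.mem_union, Finset.mem_erase, Finset.mem_insert] at hZ ⊢
    grind
  · intro Z hZ x hx y hxy hy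
    simp only [Finset.mem_union, Finset.mem_erase, Finset.mem_insert] at hZ hy
    grind

/-- A fixed-point-free involution of `Y` has a transversal containing any given set which meets
every orbit at most once. -/
theorem exists_transversal {V : Type*} [Fintype V] [DecidableEq V] (Y W : Finset V) (m : V → V)
    (hm : ∀ x ∈ Y, m x ∈ Y ∧ m (m x) = x ∧ m x ≠ x) (hWY : W ⊆ Y)
    (hW : ∀ x ∈ W, m x ∉ W) :
    ∃ S : Finset V, W ⊆ S ∧ S ⊆ Y ∧ (∀ x ∈ Y, x ∈ S ↔ m x ∉ S) ∧ 2 * S.card = Y.card := by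
  classical
  let e := Fintype.equivFin V
  let S := Y.filter fun y => y ∈ W ∨ (m y ∉ W ∧ e y < e (m y))
  have hS : ∀ x ∈ Y, x ∈ S ↔ m x ∉ S := by
    intro x hx
    obtain ⟨h1, h2, h3⟩ := hm x hx
    have hne : e x ≠ e (m x) := fun h => h3 (e.injective h).symm
    have hlt : e x < e (m x) ↔ ¬ e (m x) < e x := ⟨fun h => h.asymm, fun h => by
      rcases lt_or_gt_of_ne hne with h' | h'
      · exact h'
      · exact absurd h' h⟩
    have hWx := hW x
    simp only [S, Finset.mem_filter, hx, h1, h2, true_and, hlt]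
    tauto
  have hcard : S.card = (Y \ S).card := by
    refine Finset.card_nbij' m m ?_ ?_ ?_ ?_
    all_goals
      intro x hx
      simp only [Finset.coe_sdiff, Set.mem_sdiff, Finset.mem_coe] at hx ⊢
    · have hx' : x ∈ Y := Finset.mem_of_mem_filter x hx
      exact ⟨(hm x hx').1, (hS x hx').1 hx⟩
    · by_contra h
      exact hx.2 ((hS x hx.1).2 h)
    · exact (hm x (Finset.mem_of_mem_filter x hx)).2.1
    · exact (hm x hx.1).2.1
  have hSY : S ⊆ Y := Finset.filter_subset _ _
  refine ⟨S, fun x hx => by simp [S, hx, hWY hx], hSY, hS, ?_⟩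
  have := Finset.card_sdiff_add_card_eq_card hSY
  omega

/-- A nontrivial factor-critical part `X` contains a vertex `v` with a set `F` of at least two
neighbours, of which at least one is in `X` and those in `X` lie in different edges of a perfect
matching of `X - v`. -/
theorem exists_vertex_matching_neighbors {V : Type*} [DecidableEq V] (G : SimpleGraph V)
    (htwinfree : ∀ u v : V, u ≠ v → ¬ AreTwins G u v) (A X : Finset V)
    (hXA : ∀ x ∈ X, x ∉ A) (hclosed : ∀ x ∈ X, ∀ y, G.Adj x y → y ∉ A → y ∈ X)
    (hcrit : ∀ v ∈ X, ∃ m : V → V, ∀ x ∈ X.erase v,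
      m x ∈ X.erase v ∧ m (m x) = x ∧ G.Adj x (m x)) (hX : 1 < X.card) :
    ∃ v ∈ X, ∃ (m : V → V) (F : Finset V),
      (∀ x ∈ X.erase v, m x ∈ X.erase v ∧ m (m x) = x ∧ G.Adj x (m x)) ∧
      (∀ w ∈ F, G.Adj v w) ∧ 1 < F.card ∧ (F ∩ X).Nonempty ∧ (∀ w ∈ F, w ∈ A ∨ w ∈ X) ∧
      ∀ w ∈ F ∩ X, m w ∉ F := by
  have hnbr : ∀ v ∈ X, ∀ u ∈ X, u ≠ v → ∃ w ∈ X, w ≠ u ∧ G.Adj v w := by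
    intro v hv u hu huv
    obtain ⟨m, hm⟩ := hcrit u hu
    obtain ⟨h1, -, h3⟩ := hm v (Finset.mem_erase.2 ⟨huv.symm, hv⟩)
    exact ⟨m v, Finset.mem_of_mem_erase h1, Finset.ne_of_mem_erase h1, h3⟩
  by_cases hA : ∃ v ∈ X, ∃ a ∈ A, G.Adj v a
  · obtain ⟨v, hv, a, ha, hva⟩ := hA
    obtain ⟨u, hu, huv⟩ := Finset.exists_mem_ne hX v
    obtain ⟨w, hw, -, hvw⟩ := hnbr v hv u hu huv
    obtain ⟨m, hm⟩ := hcrit v hv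
    have hwa : w ≠ a := fun h => hXA w hw (h ▸ ha)
    have haX : a ∉ X := fun h => hXA a h ha
    refine ⟨v, hv, m, {w, a}, hm, ?_, by simp [hwa], ⟨w, by simp [hw]⟩, ?_, ?_⟩
    · simp [hvw, hva]
    · simp [hw, ha]
    · intro x hx
      obtain rfl : x = w := by
        simp only [Finset.mem_inter, Finset.mem_insert, Finset.mem_singleton] at hx
        rcases hx.1 with h | h
        · exact h
        · exact absurd (h ▸ hx.2) haX
      obtain ⟨h1, -, h3⟩ := hm x (Finset.mem_erase.2 ⟨hvw.ne', hw⟩)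
      have h4 : m x ≠ a := fun h => haX (h ▸ Finset.mem_of_mem_erase h1)
      simp [h3.ne', h4]
  · push Not at hA
    have hcl : ∀ x ∈ X, ∀ y, G.Adj x y → y ∈ X := fun x hx y hxy =>
      hclosed x hx y hxy fun h => hA x hx y h hxy
    have hpair : ∀ v ∈ X, ∀ (m : V → V), (∀ x ∈ X.erase v, m x ∈ X.erase v ∧ m (m x) = x ∧
        G.Adj x (m x)) → ∀ w₁ w₂, G.Adj v w₁ → G.Adj v w₂ → w₁ ≠ w₂ → m w₁ ≠ w₂ →
        ∃ v ∈ X, ∃ (m : V → V) (F : Finset V),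
          (∀ x ∈ X.erase v, m x ∈ X.erase v ∧ m (m x) = x ∧ G.Adj x (m x)) ∧
          (∀ w ∈ F, G.Adj v w) ∧ 1 < F.card ∧ (F ∩ X).Nonempty ∧ (∀ w ∈ F, w ∈ A ∨ w ∈ X) ∧
          ∀ w ∈ F ∩ X, m w ∉ F := by
      intro v hv m hm w₁ w₂ h₁ h₂ hne hmw
      have hw₁ := hcl v hv w₁ h₁
      have hw₂ := hcl v hv w₂ h₂
      have e₁ := hm w₁ (Finset.mem_erase.2 ⟨h₁.ne', hw₁⟩)
      have e₂ := hm w₂ (Finset.mem_erase.2 ⟨h₂.ne', hw₂⟩)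
      have hmw' : m w₂ ≠ w₁ := fun h => hmw (h ▸ e₂.2.1)
      refine ⟨v, hv, m, {w₁, w₂}, hm, by simp [h₁, h₂], by simp [hne], ⟨w₁, by simp [hw₁]⟩,
        by simp [hw₁, hw₂], ?_⟩
      intro w hw
      simp only [Finset.mem_inter, Finset.mem_insert, Finset.mem_singleton] at hw ⊢
      rcases hw.1 with rfl | rfl
      · simp [hmw, e₁.2.2.ne']
      · simp [hmw', e₂.2.2.ne']
    have hthree : ∀ v ∈ X, ∀ w₁ w₂ w₃, G.Adj v w₁ → G.Adj v w₂ → G.Adj v w₃ → w₁ ≠ w₂ →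
        w₁ ≠ w₃ → w₂ ≠ w₃ → ∃ v ∈ X, ∃ (m : V → V) (F : Finset V),
          (∀ x ∈ X.erase v, m x ∈ X.erase v ∧ m (m x) = x ∧ G.Adj x (m x)) ∧
          (∀ w ∈ F, G.Adj v w) ∧ 1 < F.card ∧ (F ∩ X).Nonempty ∧ (∀ w ∈ F, w ∈ A ∨ w ∈ X) ∧
          ∀ w ∈ F ∩ X, m w ∉ F := by
      intro v hv w₁ w₂ w₃ h₁ h₂ h₃ h₁₂ h₁₃ h₂₃
      obtain ⟨m, hm⟩ := hcrit v hv
      by_cases h : m w₁ = w₂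
      · exact hpair v hv m hm w₁ w₃ h₁ h₃ h₁₃ (h ▸ h₂₃)
      · exact hpair v hv m hm w₁ w₂ h₁ h₂ h₁₂ h
    obtain ⟨v, hv⟩ := Finset.card_pos.1 (by omega : 0 < X.card)
    obtain ⟨u, hu, huv⟩ := Finset.exists_mem_ne hX v
    obtain ⟨w₁, hw₁, -, h₁⟩ := hnbr v hv u hu huv
    obtain ⟨w₂, hw₂, h₂₁, h₂⟩ := hnbr v hv w₁ hw₁ h₁.ne'
    obtain ⟨m, hm⟩ := hcrit v hv
    by_cases h : m w₁ = w₂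
    · have h₁₂ : G.Adj w₁ w₂ := h ▸ (hm w₁ (Finset.mem_erase.2 ⟨h₁.ne', hw₁⟩)).2.2
      by_cases hz : ∃ z, z ≠ v ∧ z ≠ w₁ ∧ z ≠ w₂ ∧ (G.Adj v z ∨ G.Adj w₁ z)
      · obtain ⟨z, hzv, hz₁, hz₂, hz | hz⟩ := hz
        · exact hthree v hv w₁ w₂ z h₁ h₂ hz h₂₁.symm hz₁.symm hz₂.symm
        · exact hthree w₁ hw₁ v w₂ z h₁.symm h₁₂ hz h₂.ne hzv.symm hz₂.symm
      · refine absurd (Or.inr ?_) (htwinfree v w₁ h₁.ne)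
        push Not at hz
        ext z
        simp only [Set.mem_union, SimpleGraph.mem_neighborSet, Set.mem_singleton_iff]
        have := hz z
        have := h₁.symm
        constructor <;> rintro (h | h) <;> by_cases z = w₂ <;> grind
    · exact hpair v hv m hm w₁ w₂ h₁ h₂ h₂₁.symm h

/-- In each part `X` of the decomposition, fewer than half of the vertices, together with `A`,
locate and dominate the rest of `X`. -/
theorem exists_local_locating {V : Type*} [Fintype V] [DecidableEq V] (G : SimpleGraph V)
    (htwinfree : ∀ u v : V, u ≠ v → ¬ AreTwins G u v)
    (hnoiso : ∀ v : V, (G.neighborSet v).Nonempty) (A X : Finset V) (hodd : Odd X.card)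
    (hXA : ∀ x ∈ X, x ∉ A) (hclosed : ∀ x ∈ X, ∀ y, G.Adj x y → y ∉ A → y ∈ X)
    (hcrit : ∀ v ∈ X, ∃ m : V → V, ∀ x ∈ X.erase v,
      m x ∈ X.erase v ∧ m (m x) = x ∧ G.Adj x (m x)) :
    ∃ (S : Finset V) (f : V → Finset V), S ⊆ X ∧ 2 * S.card + 1 = X.card ∧
      ∀ u ∈ X, u ∉ S → (f u).Nonempty ∧ (∀ w ∈ f u, w ∈ A ∨ w ∈ S) ∧
        (∀ w ∈ f u, G.Adj u w) ∧ ((∃ w ∈ f u, w ∈ X) ∨ (f u : Set V) = G.neighborSet u) ∧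
        ∀ v ∈ X, v ∉ S → f u = f v → u = v := by
  classical
  rcases (Nat.succ_le_of_lt hodd.pos).eq_or_lt with hX | hX
  · obtain ⟨x, rfl⟩ := Finset.card_eq_one.1 hX.symm
    refine ⟨∅, fun u => (G.neighborSet u).toFinset, by simp, by simp, ?_⟩
    simp only [Finset.mem_singleton, forall_eq] at hclosed ⊢
    intro _
    refine ⟨by simpa using hnoiso x, fun w hw => Or.inl ?_, by simp, by simp, by simp⟩
    by_contra hwA
    have hxw : G.Adj x w := by simpa using hw
    exact hxw.ne' (hclosed w hxw hwA)
  · obtain ⟨v, hv, m, F, hm, hFadj, hFcard, hFX, hFAX, hFm⟩ :=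
      exists_vertex_matching_neighbors G htwinfree A X hXA hclosed hcrit hX
    obtain ⟨S, hFS, hSY, hS, hScard⟩ := exists_transversal (X.erase v) (F ∩ X) m
      (fun x hx => ⟨(hm x hx).1, (hm x hx).2.1, (hm x hx).2.2.ne'⟩)
      (fun w hw => by
        rw [Finset.mem_inter] at hw
        exact Finset.mem_erase.2 ⟨(hFadj w hw.1).ne', hw.2⟩)
      (fun w hw h => hFm w hw (Finset.mem_inter.1 h).1)
    have hFne : ∀ x, F ≠ {x} := fun x h => by simp [h] at hFcard
    refine ⟨S, fun u => if u = v then F else {m u}, hSY.trans (Finset.erase_subset _ _), ?_, ?_⟩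
    · rw [hScard, Finset.card_erase_of_mem hv]
      omega
    · intro u hu huS
      by_cases huv : u = v
      · subst huv
        obtain ⟨w, hw⟩ := hFX
        rw [Finset.mem_inter] at hw
        simp only [if_true]
        refine ⟨⟨w, hw.1⟩, fun z hz => ?_, hFadj, Or.inl ⟨w, hw⟩, fun z _ _ h => ?_⟩
        · exact (hFAX z hz).imp_right fun h => hFS (Finset.mem_inter.2 ⟨hz, h⟩)
        · by_contra hne
          rw [if_neg (Ne.symm hne)] at h
          exact hFne _ h
      · have huY : u ∈ X.erase v := Finset.mem_erase.2 ⟨huv, hu⟩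
        obtain ⟨h1, h2, h3⟩ := hm u huY
        have hmuS : m u ∈ S := by
          by_contra h
          exact huS ((hS u huY).2 h)
        simp only [if_neg huv, Finset.mem_singleton, forall_eq, exists_eq_left]
        refine ⟨by simp, Or.inr hmuS, h3, Or.inl (Finset.mem_of_mem_erase h1), ?_⟩
        intro z hz _ h
        by_cases hzv : z = v
        · rw [if_pos hzv] at h
          exact absurd h.symm (hFne _)
        · rw [if_neg hzv, Finset.singleton_inj] at h
          rw [← h2, h, (hm z (Finset.mem_erase.2 ⟨hzv, hz⟩)).2.1]

/-- a twin-free graph of order `n` with no isolated vertices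
satisfies `γ⃗_LD(G) ≤ n / 2`. -/
theorem stmt0 {V : Type*} [Fintype V] (G : SimpleGraph V)
    (htwinfree : ∀ u v : V, u ≠ v → ¬ AreTwins G u v)
    (hnoiso : ∀ v : V, (G.neighborSet v).Nonempty) :
    2 * lowerDirLD G ≤ Fintype.card V := by
  classical
  obtain ⟨A, P, hP, hle, hcover, hcrit⟩ := exists_isOddFamily_factorCritical G
  have hloc := fun X (hX : X ∈ P) => exists_local_locating G htwinfree hnoiso A X
    (hP.odd_card X hX) (hP.notMem X hX) (hP.closed X hX) (hcrit X hX)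
  choose! S f hSX hScard hf using hloc
  choose! part hpart hmem using hcover
  let D := A ∪ P.biUnion S
  have hD : ∀ u ∉ D, u ∉ A ∧ u ∉ S (part u) := by
    intro u hu
    simp only [D, Finset.mem_union, Finset.mem_biUnion, not_or, not_exists, not_and] at hu
    exact ⟨hu.1, hu.2 _ (hpart u hu.1)⟩
  have hf' := fun u (hu : u ∉ D) =>
    hf _ (hpart u (hD u hu).1) u (hmem u (hD u hu).1) (hD u hu).2
  have hcross : ∀ u ∉ D, ∀ v ∉ D, f (part u) u = f (part v) v → u ≠ v →
      (f (part u) u : Set V) = G.neighborSet u := by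
    intro u hu v hv h huv
    refine (hf' u hu).2.2.2.1.resolve_left ?_
    rintro ⟨w, hw, hwX⟩
    have hpu := hpart u (hD u hu).1
    have hpv := hpart v (hD v hv).1
    have hparts : part u = part v := by
      rcases (hf' v hv).2.1 w (h ▸ hw) with hwA | hwS
      · exact absurd hwA (hP.notMem _ hpu w hwX)
      · exact hP.eq_of_mem _ hpu _ hpv w hwX (hSX _ hpv hwS)
    refine huv ((hf' u hu).2.2.2.2 v (hparts ▸ hmem v (hD v hv).1) (hparts ▸ (hD v hv).2) ?_)
    rw [h, hparts]
  have hbound : lowerDirLD G ≤ D.card := by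
    refine lowerDirLD_le_card G D (fun u => f (part u) u) (fun u hu => (hf' u hu).1)
      (fun u hu w hw => ?_) (fun u hu => (hf' u hu).2.2.1) (fun u hu v hv h => ?_)
    · rcases (hf' u hu).2.1 w hw with h | h
      · exact Finset.mem_union_left _ h
      · exact Finset.mem_union_right _ (Finset.mem_biUnion.2 ⟨_, hpart u (hD u hu).1, h⟩)
    · by_contra huv
      refine htwinfree u v huv (Or.inl ?_)
      rw [← hcross u hu v hv h huv, ← hcross v hv u hu h.symm (Ne.symm huv)]
      exact congrArg _ h
  have hpd : (P : Set (Finset V)).PairwiseDisjoint id := fun X hX Y hY hXY =>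
    Finset.disjoint_left.2 fun x hx hx' => hXY (hP.eq_of_mem X hX Y hY x hx hx')
  have hdisj : Disjoint A (P.biUnion id) := by
    rw [Finset.disjoint_left]
    intro x hxA hx
    obtain ⟨X, hX, hxX⟩ := Finset.mem_biUnion.1 hx
    exact hP.notMem X hX x hxX hxA
  have htotal : A.card + ∑ X ∈ P, X.card ≤ Fintype.card V := by
    have h := Finset.card_le_univ (A ∪ P.biUnion id)
    rwa [Finset.card_union_of_disjoint hdisj, Finset.card_biUnion hpd] at h
  have hsum : ∑ X ∈ P, X.card = 2 * ∑ X ∈ P, (S X).card + P.card := by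
    rw [← Finset.sum_congr rfl hScard, Finset.sum_add_distrib, Finset.mul_sum]
    simp
  have hDcard : D.card ≤ A.card + ∑ X ∈ P, (S X).card :=
    (Finset.card_union_le _ _).trans (Nat.add_le_add_left Finset.card_biUnion_le _)
  omega
end

section
/- Let n ≥ 2 be an integer and let k be the smallest positive integer such that n ≤ k + 2^k − 1. Then γ⃗_LD(K_n) = k, where K_n is the complete graph on n vertices. -/
open SimpleGraph

/-- A locating-dominating set of size `s` in a finite digraph distinguishes at most `2 ^ s - 1`
vertices outside it. -/
theorem IsDirLDSet.card_le {V : Type*} [Finite V] {D : V → V → Prop} {S : Set V}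
    (h : IsDirLDSet D S) : Nat.card V ≤ S.ncard + 2 ^ S.ncard - 1 := by
  have hinj : Sᶜ.ncard ≤ (𝒫 S \ {∅}).ncard := by
    refine Set.ncard_le_ncard_of_injOn (fun u => {w | D w u} ∩ S) ?_ ?_ (Set.toFinite _)
    · intro u hu
      exact ⟨Set.inter_subset_right, (h.1 u hu).ne_empty⟩
    · intro u hu v hv huv
      by_contra hne
      exact h.2 u hu v hv hne huv
  rw [Set.ncard_sdiff_singleton_of_mem (Set.empty_subset S), Set.ncard_powerset] at hinj
  have hadd := Set.ncard_add_ncard_compl S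
  have hpos := Nat.one_le_two_pow (n := S.ncard)
  omega

theorem IsDirLDSet.gammaLDdir_le {V : Type*} {D : V → V → Prop} {S : Set V}
    (h : IsDirLDSet D S) : gammaLDdir D ≤ S.ncard :=
  Nat.sInf_le ⟨S, h, rfl⟩

theorem exists_isDirLDSet_ncard_eq_gammaLDdir {V : Type*} (D : V → V → Prop) :
    ∃ S : Set V, IsDirLDSet D S ∧ S.ncard = gammaLDdir D :=
  Nat.sInf_mem (s := {n | ∃ S : Set V, IsDirLDSet D S ∧ S.ncard = n})
    ⟨_, Set.univ, ⟨fun u hu => (hu (Set.mem_univ u)).elim,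
      fun u hu => (hu (Set.mem_univ u)).elim⟩, rfl⟩

theorem IsDirLDSet.ncard_pos {V : Type*} [Finite V] [Nonempty V] {D : V → V → Prop} {S : Set V}
    (h : IsDirLDSet D S) : 0 < S.ncard := by
  rw [Set.ncard_pos]
  inhabit V
  by_cases hS : (default : V) ∈ S
  · exact ⟨_, hS⟩
  · exact (h.1 _ hS).mono Set.inter_subset_right

/-- The tournament on `Fin n` in which the in-neighbours of `u ≥ k` among the vertices below `k`
are given by the binary digits of `u - k + 1`. -/
def binaryTournament (n k : ℕ) (w u : Fin n) : Prop :=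
  if w.1 < k ∧ k ≤ u.1 then (u.1 - k + 1).testBit w.1 = true
  else if u.1 < k ∧ k ≤ w.1 then ¬ (w.1 - k + 1).testBit u.1 = true
  else w < u

theorem isOrientation_binaryTournament (n k : ℕ) :
    IsOrientation (⊤ : SimpleGraph (Fin n)) (binaryTournament n k) := by
  constructor
  · rintro u v h
    rw [SimpleGraph.top_adj]
    rintro rfl
    simp only [binaryTournament] at h
    split_ifs at h
    all_goals omega
  · intro u v h
    rw [SimpleGraph.top_adj] at h
    have h' : u.1 ≠ v.1 := fun e => h (Fin.ext e)
    simp only [binaryTournament]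
    split_ifs
    · omega
    · simp
    · simp
    · rw [Fin.lt_def, Fin.lt_def]
      omega

theorem isDirLDSet_binaryTournament {n k : ℕ} (hle : n ≤ k + 2 ^ k - 1) (hkn : k ≤ n) :
    IsDirLDSet (binaryTournament n k) {i : Fin n | i.1 < k} := by
  have hmem : ∀ u : Fin n, k ≤ u.1 → ∀ j (hj : j < k),
      (⟨j, hj.trans_le hkn⟩ ∈ {w | binaryTournament n k w u} ∩ {i : Fin n | i.1 < k} ↔
        (u.1 - k + 1).testBit j = true) := by
    intro u hu j hj
    simp [binaryTournament, hj, hu]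
  have hhigh : ∀ u : Fin n, k ≤ u.1 → ∀ j, k ≤ j → (u.1 - k + 1).testBit j = false := by
    intro u hu j hj
    apply Nat.testBit_lt_two_pow
    have := Nat.pow_le_pow_right (n := 2) (by norm_num) hj
    have := u.2
    omega
  constructor
  · intro u hu
    have hu : k ≤ u.1 := not_lt.mp hu
    obtain ⟨j, hj⟩ := Nat.exists_testBit_of_ne_zero (Nat.succ_ne_zero (u.1 - k))
    have hjk : j < k := by
      by_contra hjk
      have := hhigh u hu j (not_lt.mp hjk)
      simp_all
    exact ⟨_, (hmem u hu j hjk).2 hj⟩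
  · intro u hu v hv hne heq
    have hu : k ≤ u.1 := not_lt.mp hu
    have hv : k ≤ v.1 := not_lt.mp hv
    have hbits : u.1 - k + 1 = v.1 - k + 1 := by
      apply Nat.eq_of_testBit_eq
      intro j
      rcases lt_or_ge j k with hj | hj
      · rw [Bool.eq_iff_iff, ← hmem u hu j hj, ← hmem v hv j hj, heq]
      · rw [hhigh u hu j hj, hhigh v hv j hj]
    exact hne (Fin.ext (by omega))

/-- if `n ≥ 2` and `k` is the smallest positive integer with
`n ≤ k + 2 ^ k - 1`, then `γ⃗_LD(K_n) = k`. -/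
theorem stmt1 (n k : ℕ) (hn : 2 ≤ n) (hk : 1 ≤ k)
    (hle : n ≤ k + 2 ^ k - 1)
    (hmin : ∀ j : ℕ, 1 ≤ j → n ≤ j + 2 ^ j - 1 → k ≤ j) :
    lowerDirLD (⊤ : SimpleGraph (Fin n)) = k := by
  have : NeZero n := ⟨by omega⟩
  have hkn : k ≤ n := hmin n (by omega) (by have := Nat.one_le_two_pow (n := n); omega)
  have hlower : ∀ D : Fin n → Fin n → Prop, k ≤ gammaLDdir D := by
    intro D
    obtain ⟨S, hS, hcard⟩ := exists_isDirLDSet_ncard_eq_gammaLDdir D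
    rw [← hcard]
    exact hmin _ hS.ncard_pos (by simpa using hS.card_le)
  have hcard : {i : Fin n | i.1 < k}.ncard = k := by
    rw [Set.ncard_eq_toFinset_card']
    simp [Fin.card_filter_val_lt, hkn]
  have hupper : gammaLDdir (binaryTournament n k) ≤ k :=
    (isDirLDSet_binaryTournament hle hkn).gammaLDdir_le.trans_eq hcard
  have hleast : IsLeast {m | ∃ D : Fin n → Fin n → Prop,
      IsOrientation (⊤ : SimpleGraph (Fin n)) D ∧ gammaLDdir D = m} k :=
    ⟨⟨_, isOrientation_binaryTournament n k, hupper.antisymm (hlower _)⟩,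
      by rintro _ ⟨D, -, rfl⟩; exact hlower D⟩
  exact hleast.csInf_eq
end

section
/- Let G be a graph of order n. Then (1) γ⃗_LD(G) ≤ γ_LD(G), and (2) γ⃗_LD(G) ≤ n − α'(G), where α'(G) is the maximum size of a matching in G. -/
open SimpleGraph

/-- The matching number `α'(G)`: maximum size of a set of pairwise
vertex-disjoint edges of `G`. -/
noncomputable def matchingNumber {V : Type*} (G : SimpleGraph V) : ℕ :=
  sSup {k | ∃ M : Set (Sym2 V), M ⊆ G.edgeSet ∧
    (M.Pairwise fun e f => ∀ v, ¬ (v ∈ e ∧ v ∈ f)) ∧ M.ncard = k}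

/-- If each vertex `u ∉ S` is assigned a nonempty set `P u` of neighbours of `u` in `S`, and the
sets `P u` are pairwise distinct, then some orientation of `G` has `S` as a locating-dominating
set. -/
theorem lowerDirLD_le_ncard {V : Type*} (G : SimpleGraph V) (S : Set V) (P : V → Set V)
    (hsub : ∀ u ∉ S, P u ⊆ G.neighborSet u ∩ S) (hne : ∀ u ∉ S, (P u).Nonempty)
    (hinj : Set.InjOn P Sᶜ) : lowerDirLD G ≤ S.ncard := by
  classical
  let D : V → V → Prop := fun a b => G.Adj a b ∧
    if a ∈ S then (if b ∈ S then WellOrderingRel a b else a ∈ P b)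
    else (if b ∈ S then b ∉ P a else WellOrderingRel a b)
  have hD : IsOrientation G D := by
    refine ⟨fun u v h => h.1, fun u v h => ?_⟩
    have hord : WellOrderingRel u v ↔ ¬ WellOrderingRel v u := by
      refine ⟨fun h1 h2 => asymm_of WellOrderingRel h1 h2, fun h1 => ?_⟩
      rcases trichotomous_of WellOrderingRel u v with h2 | h2 | h2
      · exact h2
      · exact absurd h2 h.ne
      · exact absurd h2 h1
    by_cases hu : u ∈ S <;> by_cases hv : v ∈ S <;> simp [D, h, h.symm, hu, hv, hord]
  have hN : ∀ u ∉ S, {w | D w u} ∩ S = P u := by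
    intro u hu
    ext w
    constructor
    · rintro ⟨hw, hwS⟩
      simpa [D, hu, hwS] using hw.2
    · intro hw
      obtain ⟨hadj, hwS⟩ := hsub u hu hw
      exact ⟨⟨hadj.symm, by simpa [hu, hwS] using hw⟩, hwS⟩
  have hS : IsDirLDSet D S := by
    refine ⟨fun u hu => hN u hu ▸ hne u hu, fun u hu v hv huv h => huv ?_⟩
    rw [hN u hu, hN v hv] at h
    exact hinj hu hv h
  have hle : gammaLDdir D ≤ S.ncard := Nat.sInf_le ⟨S, hS, rfl⟩
  have hlower : lowerDirLD G ≤ gammaLDdir D := Nat.sInf_le ⟨D, hD, rfl⟩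
  exact hlower.trans hle

theorem lowerDirLD_le_gammaLD {V : Type*} (G : SimpleGraph V) :
    lowerDirLD G ≤ gammaLD G := by
  have hne : {n | ∃ S : Set V, IsLDSet G S ∧ S.ncard = n}.Nonempty :=
    ⟨_, Set.univ, ⟨fun u hu => absurd (Set.mem_univ u) hu,
      fun u hu => absurd (Set.mem_univ u) hu⟩, rfl⟩
  obtain ⟨S, hS, hcard⟩ := Nat.sInf_mem hne
  rw [gammaLD, ← hcard]
  refine lowerDirLD_le_ncard G S (fun u => G.neighborSet u ∩ S) (fun _ _ => subset_rfl) hS.1 ?_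
  intro u hu v hv h
  by_contra huv
  exact hS.2 u hu v hv huv h

theorem lowerDirLD_le_card_sub_ncard {V : Type*} [Fintype V] (G : SimpleGraph V)
    (M : Set (Sym2 V)) (hM : M ⊆ G.edgeSet)
    (hdisj : M.Pairwise fun e f => ∀ v, ¬ (v ∈ e ∧ v ∈ f)) :
    lowerDirLD G ≤ Fintype.card V - M.ncard := by
  classical
  let a : Sym2 V → V := fun e => e.out.1
  let b : Sym2 V → V := fun e => e.out.2
  have hab : ∀ e, s(a e, b e) = e := fun e => Quot.out_eq e
  have ha : ∀ e, a e ∈ e := fun e => by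
    simpa [hab e] using Sym2.mem_mk_left (a e) (b e)
  have hb : ∀ e, b e ∈ e := fun e => by
    simpa [hab e] using Sym2.mem_mk_right (a e) (b e)
  have hadj : ∀ e ∈ M, G.Adj (a e) (b e) := fun e he => by
    rw [← SimpleGraph.mem_edgeSet, hab]; exact hM he
  have heq : ∀ e ∈ M, ∀ f ∈ M, ∀ v, v ∈ e → v ∈ f → e = f := fun e he f hf v hve hvf => by
    by_contra h
    exact hdisj he hf h v ⟨hve, hvf⟩
  have hbinj : Set.InjOn b M := fun e he f hf h => heq e he f hf (b e) (hb e) (h ▸ hb f)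
  have hcard : ((b '' M)ᶜ).ncard = Fintype.card V - M.ncard := by
    rw [Set.ncard_compl, hbinj.ncard_image, Nat.card_eq_fintype_card]
  rw [← hcard]
  have hP : ∀ e ∈ M, {w | ∃ f ∈ M, b f = b e ∧ w = a f} = {a e} := by
    intro e he
    ext w
    constructor
    · rintro ⟨f, hf, hfe, rfl⟩
      rw [hbinj hf he hfe]; rfl
    · rintro rfl
      exact ⟨e, he, rfl, rfl⟩
  refine lowerDirLD_le_ncard G _ (fun u => {w | ∃ e ∈ M, b e = u ∧ w = a e}) ?_ ?_ ?_
  · rintro u - w ⟨e, he, rfl, rfl⟩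
    refine ⟨(hadj e he).symm, ?_⟩
    rintro ⟨f, hf, hfe⟩
    have hef := heq e he f hf (a e) (ha e) (hfe ▸ hb f)
    subst hef
    exact (hadj e he).ne hfe.symm
  · intro u hu
    obtain ⟨e, he, rfl⟩ := not_not.mp hu
    exact ⟨a e, e, he, rfl, rfl⟩
  · intro u hu v hv h
    obtain ⟨e, he, rfl⟩ := not_not.mp hu
    obtain ⟨f, hf, rfl⟩ := not_not.mp hv
    simp only [hP e he, hP f hf, Set.singleton_eq_singleton_iff] at h
    rw [heq e he f hf (a e) (ha e) (h ▸ ha f)]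

theorem exists_matching_ncard_eq_matchingNumber {V : Type*} [Finite V] (G : SimpleGraph V) :
    ∃ M : Set (Sym2 V), M ⊆ G.edgeSet ∧
      (M.Pairwise fun e f => ∀ v, ¬ (v ∈ e ∧ v ∈ f)) ∧ M.ncard = matchingNumber G := by
  have hfin : Finite (Sym2 V) := Quot.finite _
  have hne : {k | ∃ M : Set (Sym2 V), M ⊆ G.edgeSet ∧
      (M.Pairwise fun e f => ∀ v, ¬ (v ∈ e ∧ v ∈ f)) ∧ M.ncard = k}.Nonempty :=
    ⟨0, ∅, Set.empty_subset _, Set.pairwise_empty _, Set.ncard_empty _⟩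
  refine Nat.sSup_mem hne ⟨Nat.card (Sym2 V), ?_⟩
  rintro _ ⟨M, -, -, rfl⟩
  exact Set.ncard_le_card M

/-- `γ⃗_LD(G) ≤ γ_LD(G)` and `γ⃗_LD(G) ≤ n - α'(G)`. -/
theorem stmt2 {V : Type*} [Fintype V] (G : SimpleGraph V) :
    lowerDirLD G ≤ gammaLD G ∧
      lowerDirLD G ≤ Fintype.card V - matchingNumber G := by
  obtain ⟨M, hM, hdisj, hcard⟩ := exists_matching_ncard_eq_matchingNumber G
  exact ⟨lowerDirLD_le_gammaLD G, hcard ▸ lowerDirLD_le_card_sub_ncard G M hM hdisj⟩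
end

section
/- For any connected graph G of order n ≥ 2, γ⃗_LD(G) = n − 1 if and only if n = 3 or G is a star (a complete bipartite graph K_{1,m} for some m ≥ 1). -/
open SimpleGraph

/-- `G` is a star: there is a centre `c` and the edges of `G` are exactly the
pairs `{c, v}` with `v ≠ c`. -/
def IsStar {V : Type*} (G : SimpleGraph V) : Prop :=
  ∃ c : V, ∀ u v : V, G.Adj u v ↔ (u = c ∧ v ≠ c) ∨ (v = c ∧ u ≠ c)

/-- The graph `G` has two vertex-disjoint edges `au` and `bv`. -/
def HasDisjointEdges {V : Type*} (G : SimpleGraph V) : Prop :=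
  ∃ a u b v : V, G.Adj a u ∧ G.Adj b v ∧ a ≠ b ∧ u ≠ v ∧ a ≠ v ∧ b ≠ u

/-- Any asymmetric set of prescribed directions extends to an orientation. -/
theorem exists_isOrientation_extending {V : Type*} [Fintype V] (G : SimpleGraph V)
    (R : V → V → Prop) (hR : ∀ x y, R x y → ¬ R y x) :
    ∃ D, IsOrientation G D ∧ ∀ x y, G.Adj x y → R x y → D x y := by
  let e := Fintype.equivFin V
  refine ⟨fun x y => G.Adj x y ∧ (R x y ∨ (¬ R y x ∧ e x < e y)),
    ⟨fun x y h => h.1, fun x y h => ?_⟩, fun x y h hxy => ⟨h, Or.inl hxy⟩⟩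
  have hne : e x ≠ e y := e.injective.ne h.ne
  have h1 := hR x y
  have h2 := h.symm
  rcases lt_or_gt_of_ne hne with h3 | h3
  · have := h3.not_gt
    tauto
  · have := h3.not_gt
    tauto

theorem lowerDirLD_le_ncard_s3 {V : Type*} {G : SimpleGraph V} {D : V → V → Prop} {S : Set V}
    (hD : IsOrientation G D) (hS : IsDirLDSet D S) : lowerDirLD G ≤ S.ncard := by
  have h1 : lowerDirLD G ≤ gammaLDdir D := Nat.sInf_le ⟨D, hD, rfl⟩
  have h2 : gammaLDdir D ≤ S.ncard := Nat.sInf_le ⟨S, hS, rfl⟩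
  exact h1.trans h2

theorem exists_isDirLDSet_ncard_eq_lowerDirLD {V : Type*} [Fintype V] (G : SimpleGraph V) :
    ∃ D S, IsOrientation G D ∧ IsDirLDSet D S ∧ S.ncard = lowerDirLD G := by
  obtain ⟨D₀, hD₀, -⟩ := exists_isOrientation_extending G (fun _ _ => False) (by simp)
  obtain ⟨D, hD, hDn⟩ := Nat.sInf_mem
    (s := {n | ∃ D : V → V → Prop, IsOrientation G D ∧ gammaLDdir D = n}) ⟨_, D₀, hD₀, rfl⟩
  have hU : IsDirLDSet D Set.univ := ⟨by simp, by simp⟩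
  obtain ⟨S, hS, hSn⟩ := Nat.sInf_mem (s := {n | ∃ S : Set V, IsDirLDSet D S ∧ S.ncard = n})
    ⟨_, Set.univ, hU, rfl⟩
  exact ⟨D, S, hD, hS, hSn.trans hDn⟩

theorem lowerDirLD_le_card_sub_one {V : Type*} [Fintype V] {G : SimpleGraph V} {a v : V}
    (h : G.Adj a v) : lowerDirLD G ≤ Fintype.card V - 1 := by
  obtain ⟨D, hD, hRD⟩ := exists_isOrientation_extending G (fun x y => x = a ∧ y = v)
    (by rintro x y ⟨rfl, rfl⟩ ⟨h1, -⟩; exact h.ne h1.symm)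
  have hS : IsDirLDSet D {v}ᶜ := by
    constructor
    · intro u hu
      obtain rfl : u = v := by simpa using hu
      exact ⟨a, hRD _ _ h ⟨rfl, rfl⟩, h.ne⟩
    · intro u hu w hw huw
      simp only [Set.mem_compl_iff, Set.mem_singleton_iff, not_not] at hu hw
      exact absurd (hu.trans hw.symm) huw
  have h1 := lowerDirLD_le_ncard_s3 hD hS
  rwa [Set.ncard_compl, Set.ncard_singleton, Nat.card_eq_fintype_card] at h1

theorem HasDisjointEdges.lowerDirLD_le {V : Type*} [Fintype V] {G : SimpleGraph V}
    (h : HasDisjointEdges G) : lowerDirLD G ≤ Fintype.card V - 2 := by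
  obtain ⟨a, u, b, v, hau, hbv, hab, huv, hav, hbu⟩ := h
  have hau' := hau.ne
  have hbv' := hbv.ne
  obtain ⟨D, hD, hRD⟩ := exists_isOrientation_extending G
    (fun x y => (x = a ∧ y = u) ∨ (x = b ∧ y = v) ∨ (x = u ∧ y = b) ∨ (x = v ∧ y = a))
    (by grind)
  have ha : D a u := hRD _ _ hau (by simp)
  have hb : D b v := hRD _ _ hbv (by simp)
  have hna : ¬ D a v := fun h1 =>
    (hD.2 _ _ (hD.1 _ _ h1)).1 h1 (hRD _ _ (hD.1 _ _ h1).symm (by simp))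
  have hS : IsDirLDSet D {u, v}ᶜ := by
    constructor
    · intro w hw
      have hw : w = u ∨ w = v := by simpa [-not_or, or_iff_not_imp_left] using hw
      rcases hw with rfl | rfl
      · exact ⟨a, ha, by simp [hau', hav]⟩
      · exact ⟨b, hb, by simp [hbv', hbu]⟩
    · intro w hw x hx hwx heq
      have haS : a ∈ ({u, v}ᶜ : Set V) := by simp [hau', hav]
      simp only [Set.mem_compl_iff, not_not, Set.mem_insert_iff, Set.mem_singleton_iff] at hw hx
      have key : D a w ↔ D a x := by
        simpa [haS, hau', hav] using Set.ext_iff.1 heq a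
      grind
  have h1 := lowerDirLD_le_ncard_s3 hD hS
  rwa [Set.ncard_compl, Set.ncard_pair huv, Nat.card_eq_fintype_card] at h1

theorem IsDirLDSet.hasDisjointEdges {V : Type*} [Fintype V] {G : SimpleGraph V}
    {D : V → V → Prop} {S : Set V} (hD : IsOrientation G D) (hS : IsDirLDSet D S)
    (hcard : S.ncard + 1 < Fintype.card V) : HasDisjointEdges G := by
  have hc : 1 < Sᶜ.ncard := by
    rw [Set.ncard_compl, Nat.card_eq_fintype_card]
    omega
  obtain ⟨u, hu, v, hv, huv⟩ := (Set.one_lt_ncard (Set.toFinite _)).1 hc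
  obtain ⟨a, b, ha, hb, hab⟩ : ∃ a b, a ∈ {w | D w u} ∩ S ∧ b ∈ {w | D w v} ∩ S ∧ a ≠ b := by
    by_contra! hcon
    obtain ⟨a, ha⟩ := hS.1 u hu
    obtain ⟨b, hb⟩ := hS.1 v hv
    refine hS.2 u hu v hv huv (Set.Subset.antisymm (fun x hx => ?_) fun x hx => ?_)
    · exact hcon x b hx hb ▸ hb
    · exact hcon a x ha hx ▸ ha
  exact ⟨a, u, b, v, hD.1 _ _ ha.1, hD.1 _ _ hb.1, hab, huv,
    ne_of_mem_of_not_mem ha.2 hv, ne_of_mem_of_not_mem hb.2 hu⟩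

theorem lowerDirLD_eq_card_sub_one_iff {V : Type*} [Fintype V] {G : SimpleGraph V} {a v : V}
    (h : G.Adj a v) (hn : 2 ≤ Fintype.card V) :
    lowerDirLD G = Fintype.card V - 1 ↔ ¬ HasDisjointEdges G := by
  refine ⟨fun heq hE => ?_, fun hE => ?_⟩
  · have := hE.lowerDirLD_le
    omega
  · obtain ⟨D, S, hD, hS, hSn⟩ := exists_isDirLDSet_ncard_eq_lowerDirLD G
    have h1 := lowerDirLD_le_card_sub_one h
    by_contra hne
    exact hE (hS.hasDisjointEdges hD (by omega))

theorem HasDisjointEdges.four_le_card {V : Type*} [Fintype V] {G : SimpleGraph V}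
    (h : HasDisjointEdges G) : 4 ≤ Fintype.card V := by
  classical
  obtain ⟨a, u, b, v, hau, hbv, hab, huv, hav, hbu⟩ := h
  have h4 : ({a, u, b, v} : Finset V).card = 4 := by
    rw [Finset.card_insert_of_notMem, Finset.card_insert_of_notMem,
      Finset.card_pair hbv.ne] <;> simp [hau.ne, hab, hav, huv, hbu.symm]
  exact h4 ▸ Finset.card_le_univ _

theorem IsStar.not_hasDisjointEdges {V : Type*} {G : SimpleGraph V} (h : IsStar G) :
    ¬ HasDisjointEdges G := by
  rintro ⟨a, u, b, v, hau, hbv, hab, huv, hav, hbu⟩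
  obtain ⟨c, hc⟩ := h
  rw [hc] at hau hbv
  grind

theorem isStar_of_not_hasDisjointEdges {V : Type*} {G : SimpleGraph V}
    (hG : ∀ x, ∃ y, G.Adj x y) (h : ¬ HasDisjointEdges G) {a b w x : V} (hab : G.Adj a b)
    (hw : w ≠ b) (hwa : G.Adj a w) (hxa : x ≠ a) (hxb : x ≠ b) (hxw : x ≠ w) : IsStar G := by
  have H : ∀ p q r s, G.Adj p q → G.Adj r s → p = r ∨ q = s ∨ p = s ∨ r = q := by
    intro p q r s h1 h2
    by_contra! h3
    exact h ⟨p, q, r, s, h1, h2, h3.1, h3.2.1, h3.2.2.1, h3.2.2.2⟩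
  have hx : G.Adj a x := by
    obtain ⟨y, hy⟩ := hG x
    have h1 := H _ _ _ _ hab hy
    have h2 := H _ _ _ _ hwa hy
    have : y = a := by grind
    exact this ▸ hy.symm
  have hmem : ∀ p q, G.Adj p q → p = a ∨ q = a := by
    intro p q hpq
    have h1 := H _ _ _ _ hab hpq
    have h2 := H _ _ _ _ hwa hpq
    have h3 := H _ _ _ _ hx hpq
    grind
  have hadj : ∀ p, p ≠ a → G.Adj a p := by
    intro p hp
    obtain ⟨q, hq⟩ := hG p
    rcases hmem _ _ hq with h1 | h1
    · exact absurd h1 hp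
    · exact h1 ▸ hq.symm
  refine ⟨a, fun p q => ⟨fun hpq => ?_, ?_⟩⟩
  · have := hpq.ne
    grind
  · rintro (⟨rfl, hq⟩ | ⟨rfl, hp⟩)
    · exact hadj _ hq
    · exact (hadj _ hp).symm

theorem isStar_of_card_eq_two {V : Type*} [Fintype V] {G : SimpleGraph V} {a b : V}
    (hab : G.Adj a b) (hn : Fintype.card V = 2) : IsStar G := by
  classical
  have hV : ∀ x, x = a ∨ x = b := by
    intro x
    have : ({a, b} : Finset V) = Finset.univ := by
      rw [← Finset.card_eq_iff_eq_univ, Finset.card_pair hab.ne, hn]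
    simpa [← this] using Finset.mem_univ x
  refine ⟨a, fun p q => ?_⟩
  have h1 := hab.ne
  have h2 := h1.symm
  have h3 := hab.symm
  rcases hV p with rfl | rfl <;> rcases hV q with rfl | rfl <;> simp_all

/-- for a connected graph `G` of order `n ≥ 2`,
`γ⃗_LD(G) = n - 1` iff `n = 3` or `G` is a star. -/
theorem stmt3 {V : Type*} [Fintype V] (G : SimpleGraph V)
    (hconn : G.Connected) (hn : 2 ≤ Fintype.card V) :
    lowerDirLD G = Fintype.card V - 1 ↔ Fintype.card V = 3 ∨ IsStar G := by
  classical
  have : Nontrivial V := Fintype.one_lt_card_iff_nontrivial.1 hn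
  have hG : ∀ x, ∃ y, G.Adj x y := hconn.preconnected.exists_adj_of_nontrivial
  obtain ⟨a⟩ := hconn.nonempty
  obtain ⟨b, hab⟩ := hG a
  rw [lowerDirLD_eq_card_sub_one_iff hab hn]
  constructor
  · intro h
    refine or_iff_not_imp_left.2 fun h3 => ?_
    rcases hn.eq_or_lt with h2 | h2
    · exact isStar_of_card_eq_two hab h2.symm
    have hc : 1 < ({a, b}ᶜ : Finset V).card := by
      rw [Finset.card_compl, Finset.card_pair hab.ne]
      omega
    obtain ⟨w, hw, x, hx, hwx⟩ := Finset.one_lt_card.1 hc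
    simp only [Finset.mem_compl, Finset.mem_insert, Finset.mem_singleton, not_or] at hw hx
    obtain ⟨y, hy⟩ := hG w
    by_cases hya : y = a
    · exact isStar_of_not_hasDisjointEdges hG h hab hw.2 (hya ▸ hy.symm) hx.1 hx.2 hwx.symm
    by_cases hyb : y = b
    · exact isStar_of_not_hasDisjointEdges hG h hab.symm hw.1 (hyb ▸ hy.symm) hx.2 hx.1 hwx.symm
    · exact absurd ⟨a, b, w, y, hab, hy, Ne.symm hw.1, Ne.symm hyb, Ne.symm hya, hw.2⟩ h
  · rintro (h3 | hs) hE
    · have := hE.four_le_card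
      omega
    · exact hs.not_hasDisjointEdges hE
end

section
/- Let G be a graph that contains no cycle of length 4 as a (not necessarily induced) subgraph. Then γ⃗_LD(G) = γ_LD(G). -/
open SimpleGraph

/-- `G` contains no cycle of length 4 as a (not necessarily induced) subgraph. -/
def C4Free {V : Type*} (G : SimpleGraph V) : Prop :=
  ¬ ∃ a b c d : V, a ≠ b ∧ a ≠ c ∧ a ≠ d ∧ b ≠ c ∧ b ≠ d ∧ c ≠ d ∧
      G.Adj a b ∧ G.Adj b c ∧ G.Adj c d ∧ G.Adj d a

theorem C4Free.eq_of_common_neighbors {V : Type*} {G : SimpleGraph V} (h : C4Free G)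
    {u v a b : V} (huv : u ≠ v) (hua : G.Adj u a) (hva : G.Adj v a) (hub : G.Adj u b)
    (hvb : G.Adj v b) : a = b := by
  by_contra hab
  exact h ⟨u, a, v, b, hua.ne, huv, hub.ne, hva.ne', hab, hvb.ne, hua, hva.symm, hvb, hub.symm⟩

/-- In a `C₄`-free graph, a locating-dominating set of an orientation is a
locating-dominating set of the underlying graph. -/
theorem IsDirLDSet.isLDSet {V : Type*} {G : SimpleGraph V} {D : V → V → Prop} {S : Set V}
    (hS : IsDirLDSet D S) (h : C4Free G) (hD : IsOrientation G D) : IsLDSet G S := by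
  refine ⟨fun u hu => ?_, fun u hu v hv huv heq => hS.2 u hu v hv huv ?_⟩
  · obtain ⟨w, hw, hwS⟩ := hS.1 u hu
    exact ⟨w, (hD.1 _ _ hw).symm, hwS⟩
  · obtain ⟨a, ha, haS⟩ := hS.1 u hu
    obtain ⟨b, hb, hbS⟩ := hS.1 v hv
    have adj_iff : ∀ w ∈ S, (G.Adj u w ↔ G.Adj v w) := fun w hw => by
      simpa [hw] using Set.ext_iff.1 heq w
    have hua : G.Adj u a := (hD.1 _ _ ha).symm
    have hvb : G.Adj v b := (hD.1 _ _ hb).symm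
    have eq_a : ∀ w ∈ S, G.Adj u w → w = a := fun w hw huw =>
      h.eq_of_common_neighbors huv huw ((adj_iff w hw).1 huw) hua ((adj_iff a haS).1 hua)
    obtain rfl := eq_a b hbS ((adj_iff b hbS).2 hvb)
    ext w
    constructor
    · rintro ⟨hw, hwS⟩
      obtain rfl := eq_a w hwS (hD.1 _ _ hw).symm
      exact ⟨hb, hwS⟩
    · rintro ⟨hw, hwS⟩
      obtain rfl := eq_a w hwS ((adj_iff w hwS).2 (hD.1 _ _ hw).symm)
      exact ⟨ha, hwS⟩

/-- Every graph has an orientation in which all edges between `S` and its complement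
leave `S`. -/
theorem exists_isOrientation_outward {V : Type*} (G : SimpleGraph V) (S : Set V) :
    ∃ D : V → V → Prop, IsOrientation G D ∧ ∀ w ∈ S, ∀ u ∉ S, (D w u ↔ G.Adj u w) := by
  refine ⟨fun u v => G.Adj u v ∧ (u ∈ S ∧ v ∉ S ∨ ((u ∈ S ↔ v ∈ S) ∧ WellOrderingRel u v)),
    ⟨fun u v huv => huv.1, fun u v huv => ?_⟩, fun w hw u hu => by simp [hw, hu, G.adj_comm]⟩
  have h_asymm : WellOrderingRel u v → ¬ WellOrderingRel v u := asymm
  have h_total := trichotomous_of WellOrderingRel u v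
  have h_ne := huv.ne
  have h_symm := huv.symm
  tauto

theorem IsLDSet.isDirLDSet {V : Type*} {G : SimpleGraph V} {D : V → V → Prop} {S : Set V}
    (hS : IsLDSet G S) (hD : ∀ w ∈ S, ∀ u ∉ S, (D w u ↔ G.Adj u w)) : IsDirLDSet D S := by
  have key : ∀ u ∉ S, {w | D w u} ∩ S = G.neighborSet u ∩ S := fun u hu => by
    ext w
    exact and_congr_left fun hw => hD w hw u hu
  refine ⟨fun u hu => ?_, fun u hu v hv huv => ?_⟩
  · rw [key u hu]
    exact hS.1 u hu
  · rw [key u hu, key v hv]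
    exact hS.2 u hu v hv huv

theorem isLDSet_univ {V : Type*} (G : SimpleGraph V) : IsLDSet G Set.univ :=
  ⟨fun u hu => absurd (Set.mem_univ u) hu, fun u hu => absurd (Set.mem_univ u) hu⟩

theorem isDirLDSet_univ {V : Type*} (D : V → V → Prop) : IsDirLDSet D Set.univ :=
  ⟨fun u hu => absurd (Set.mem_univ u) hu, fun u hu => absurd (Set.mem_univ u) hu⟩

/-- if `G` has no `C₄` subgraph, then `γ⃗_LD(G) = γ_LD(G)`. -/
theorem stmt4 {V : Type*} [Fintype V] (G : SimpleGraph V) (h : C4Free G) :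
    lowerDirLD G = gammaLD G := by
  obtain ⟨S, hS, hScard⟩ : gammaLD G ∈ {n | ∃ S : Set V, IsLDSet G S ∧ S.ncard = n} :=
    Nat.sInf_mem ⟨_, Set.univ, isLDSet_univ G, rfl⟩
  obtain ⟨D, hD, hDS⟩ := exists_isOrientation_outward G S
  apply le_antisymm
  · calc lowerDirLD G ≤ gammaLDdir D := Nat.sInf_le ⟨D, hD, rfl⟩
      _ ≤ S.ncard := Nat.sInf_le ⟨S, hS.isDirLDSet hDS, rfl⟩
      _ = gammaLD G := hScard
  · obtain ⟨E, hE, hEcard⟩ :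
        lowerDirLD G ∈ {n | ∃ D : V → V → Prop, IsOrientation G D ∧ gammaLDdir D = n} :=
      Nat.sInf_mem ⟨_, D, hD, rfl⟩
    obtain ⟨T, hT, hTcard⟩ : gammaLDdir E ∈ {n | ∃ T : Set V, IsDirLDSet E T ∧ T.ncard = n} :=
      Nat.sInf_mem ⟨_, Set.univ, isDirLDSet_univ E, rfl⟩
    rw [← hEcard, ← hTcard]
    exact Nat.sInf_le ⟨T, hT.isLDSet h hE, rfl⟩
end

section
/- Let G be an undirected graph. Then γ⃗_LD(G) = min{ γ_LD(H) : H is a spanning subgraph of G }, where a spanning subgraph of G is a subgraph H with V(H) = V(G) and E(H) ⊆ E(G). -/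
open SimpleGraph

/-- Two sets of natural numbers each of which is coinitial in the other have the same infimum. -/
theorem Nat.sInf_eq_of_forall_exists_le {A B : Set ℕ} (hAB : ∀ a ∈ A, ∃ b ∈ B, b ≤ a)
    (hBA : ∀ b ∈ B, ∃ a ∈ A, a ≤ b) : sInf A = sInf B := by
  rcases A.eq_empty_or_nonempty with rfl | hA
  · have : B = ∅ := Set.eq_empty_of_forall_notMem fun b hb => by
      obtain ⟨a, ha, -⟩ := hBA b hb
      exact ha
    rw [this]
  · obtain ⟨b, hb, hba⟩ := hAB _ (Nat.sInf_mem hA)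
    obtain ⟨a, ha, hab⟩ := hBA _ (Nat.sInf_mem ⟨b, hb⟩)
    exact le_antisymm ((Nat.sInf_le ha).trans hab) ((Nat.sInf_le hb).trans hba)

theorem exists_isLDSet_ncard_eq_gammaLD {V : Type*} (G : SimpleGraph V) :
    ∃ S : Set V, IsLDSet G S ∧ S.ncard = gammaLD G :=
  have h : {n | ∃ S : Set V, IsLDSet G S ∧ S.ncard = n}.Nonempty := ⟨_, Set.univ, isLDSet_univ G, rfl⟩
  Nat.sInf_mem h

/-- Whether `S` is locating-dominating only depends on the arcs from `S` to its complement. -/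
theorem isLDSet_iff_isDirLDSet {V : Type*} {H : SimpleGraph V} {D : V → V → Prop} {S : Set V}
    (h : ∀ w ∈ S, ∀ u ∉ S, (H.Adj w u ↔ D w u)) : IsLDSet H S ↔ IsDirLDSet D S := by
  have key : ∀ u ∉ S, H.neighborSet u ∩ S = {w | D w u} ∩ S := fun u hu => by
    ext w
    simp only [Set.mem_inter_iff, mem_neighborSet, Set.mem_ofPred_eq, and_congr_left_iff]
    exact fun hw => H.adj_comm u w |>.trans (h w hw u hu)
  unfold IsLDSet IsDirLDSet
  refine and_congr (forall₂_congr fun u hu => by rw [key u hu])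
    (forall₂_congr fun u hu => forall₂_congr fun v hv => by rw [key u hu, key v hv])

/-- An orientation of `G` agrees, on the arcs leaving `S`, with some spanning subgraph of `G`. -/
theorem IsOrientation.exists_le_adj_iff {V : Type*} {G : SimpleGraph V} {D : V → V → Prop}
    (hD : IsOrientation G D) (S : Set V) :
    ∃ H ≤ G, ∀ w ∈ S, ∀ u ∉ S, (H.Adj w u ↔ D w u) := by
  refine ⟨⟨fun u v => (u ∈ S ∧ v ∉ S ∧ D u v) ∨ (v ∈ S ∧ u ∉ S ∧ D v u),
    ⟨fun u v h => h.symm⟩, ⟨fun u h => by tauto⟩⟩, ?_, ?_⟩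
  · rintro u v (⟨-, -, h⟩ | ⟨-, -, h⟩)
    · exact hD.1 _ _ h
    · exact (hD.1 _ _ h).symm
  · intro w hw u hu
    change (_ ∨ _) ↔ _
    tauto

/-- A spanning subgraph of `G` agrees, on the arcs leaving `S`, with some orientation of `G`:
orient the edges of `H` between `S` and its complement away from `S`, the other edges of `G` between
them towards `S`, and the remaining edges along a linear order. -/
theorem exists_isOrientation_adj_iff {V : Type*} {G H : SimpleGraph V} (hH : H ≤ G) (S : Set V) :
    ∃ D, IsOrientation G D ∧ ∀ w ∈ S, ∀ u ∉ S, (H.Adj w u ↔ D w u) := by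
  let r : V → V → Prop := WellOrderingRel
  refine ⟨fun u v => G.Adj u v ∧ ((u ∈ S ∧ v ∉ S ∧ H.Adj u v) ∨
    (u ∉ S ∧ v ∈ S ∧ ¬ H.Adj u v) ∨ ((u ∈ S ↔ v ∈ S) ∧ r u v)), ⟨fun u v h => h.1, ?_⟩, ?_⟩
  · intro u v huv
    have h₁ : r u v ↔ ¬ r v u :=
      ⟨fun h h' => asymm_of WellOrderingRel h h', fun h =>
        ((trichotomous_of WellOrderingRel u v).resolve_right
          (not_or.2 ⟨huv.ne, h⟩))⟩
    have h₂ := H.adj_comm u v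
    by_cases hu : u ∈ S <;> by_cases hv : v ∈ S <;> simp [hu, hv, huv, huv.symm, h₁, h₂]
  · intro w hw u hu
    have := @hH w u
    tauto

/-- `γ⃗_LD(G)` equals the minimum of `γ_LD(H)` over all spanning
subgraphs `H` of `G` (i.e. graphs on the same vertex set with `H ≤ G`). -/
theorem stmt5 {V : Type*} [Fintype V] (G : SimpleGraph V) :
    lowerDirLD G = sInf {n | ∃ H : SimpleGraph V, H ≤ G ∧ gammaLD H = n} := by
  refine Nat.sInf_eq_of_forall_exists_le ?_ ?_
  · rintro _ ⟨D, hD, rfl⟩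
    obtain ⟨S, hS, hcard⟩ := exists_isDirLDSet_ncard_eq_gammaLDdir D
    obtain ⟨H, hHG, hHD⟩ := hD.exists_le_adj_iff S
    exact ⟨_, ⟨H, hHG, rfl⟩, Nat.sInf_le ⟨S, (isLDSet_iff_isDirLDSet hHD).2 hS, hcard⟩⟩
  · rintro _ ⟨H, hHG, rfl⟩
    obtain ⟨S, hS, hcard⟩ := exists_isLDSet_ncard_eq_gammaLD H
    obtain ⟨D, hD, hHD⟩ := exists_isOrientation_adj_iff hHG S
    exact ⟨_, ⟨D, hD, rfl⟩, Nat.sInf_le ⟨S, (isLDSet_iff_isDirLDSet hHD).1 hS, hcard⟩⟩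
end

section
/- Let G be a graph of order n. Then γ⃗_LD(G) ≥ 2n/(Δ(G) + 3), where Δ(G) is the maximum degree of G. -/
open SimpleGraph

theorem exists_isOrientation {V : Type*} (G : SimpleGraph V) :
    ∃ D : V → V → Prop, IsOrientation G D := by
  classical
  refine ⟨fun u v => G.Adj u v ∧ WellOrderingRel u v, fun u v h => h.1, fun u v h => ?_⟩
  refine ⟨fun h1 h2 => asymm_of WellOrderingRel h1.2 h2.2, fun h1 => ⟨h, ?_⟩⟩
  rcases trichotomous_of WellOrderingRel u v with h2 | h2 | h2
  · exact h2
  · exact absurd h2 h.ne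
  · exact absurd ⟨h.symm, h2⟩ h1

theorem exists_isOrientation_gammaLDdir_eq_lowerDirLD {V : Type*} (G : SimpleGraph V) :
    ∃ D : V → V → Prop, IsOrientation G D ∧ gammaLDdir D = lowerDirLD G :=
  Nat.sInf_mem (s := {n | ∃ D : V → V → Prop, IsOrientation G D ∧ gammaLDdir D = n})
    (let ⟨D, hD⟩ := exists_isOrientation G; ⟨_, D, hD, rfl⟩)

/-- At most `#S` vertices outside `S` have a single in-neighbour in `S`, the others have at least
two, and at most `#S * d` arcs leave `S`. -/
theorem two_mul_card_le_of_isDirLDSet {V : Type*} [Fintype V] {D : V → V → Prop} {S : Finset V}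
    (hS : IsDirLDSet D S) {d : ℕ} (hd : ∀ w, {u | D w u}.ncard ≤ d) :
    2 * Fintype.card V ≤ S.card * (d + 3) := by
  classical
  let I : V → Finset V := fun u => S.filter fun w => D w u
  have hI (u : V) : (I u : Set V) = {w | D w u} ∩ S := by
    ext w
    simp [I, and_comm]
  have h_pos : ∀ u ∈ Sᶜ, 1 ≤ (I u).card := fun u hu => by
    rw [Nat.one_le_iff_ne_zero, Finset.card_ne_zero, ← Finset.coe_nonempty, hI]
    exact hS.1 u (by simpa using hu)
  have h_inj : Set.InjOn I (Sᶜ : Finset V) := fun u hu v hv h => by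
    by_contra hne
    exact hS.2 u (by simpa using hu) v (by simpa using hv) hne (by rw [← hI, ← hI, h])
  have h_one : (Sᶜ.filter fun u => (I u).card = 1).card ≤ S.card := by
    calc _ ≤ (S.powersetCard 1).card :=
          Finset.card_le_card_of_injOn I
            (fun u hu => by
              rw [Finset.mem_coe, Finset.mem_powersetCard]
              exact ⟨Finset.filter_subset _ _, (Finset.mem_filter.1 hu).2⟩)
            (h_inj.mono (by exact_mod_cast Finset.filter_subset _ _))
      _ = S.card := by simp
  have h_arcs : ∑ u ∈ Sᶜ, (I u).card ≤ S.card * d := by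
    calc ∑ u ∈ Sᶜ, (I u).card = ∑ w ∈ S, (Sᶜ.filter fun u => D w u).card :=
          (Finset.sum_card_bipartiteAbove_eq_sum_card_bipartiteBelow D).symm
      _ ≤ ∑ _w ∈ S, d := Finset.sum_le_sum fun w _ => by
          refine le_trans ?_ (hd w)
          rw [← Set.ncard_coe_finset]
          exact Set.ncard_le_ncard (fun u hu => (Finset.mem_filter.1 hu).2)
      _ = S.card * d := by simp
  have h_two : Sᶜ.card * 2 ≤
      ∑ u ∈ Sᶜ, (I u).card + (Sᶜ.filter fun u => (I u).card = 1).card := by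
    rw [Finset.card_filter, ← Finset.sum_add_distrib, ← smul_eq_mul, ← Finset.sum_const]
    refine Finset.sum_le_sum fun u hu => ?_
    have := h_pos u hu
    split_ifs <;> omega
  have := S.card_add_card_compl
  rw [mul_add]
  omega

/-- `γ⃗_LD(G) ≥ 2n / (Δ(G) + 3)`. -/
theorem stmt6 {V : Type*} [Fintype V] (G : SimpleGraph V)
    [DecidableRel G.Adj] :
    (2 * (Fintype.card V : ℝ)) / ((G.maxDegree : ℝ) + 3) ≤ (lowerDirLD G : ℝ) := by
  obtain ⟨D, hD, hDk⟩ := exists_isOrientation_gammaLDdir_eq_lowerDirLD G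
  obtain ⟨S, hS, hSk⟩ := exists_isDirLDSet_ncard_eq_gammaLDdir D
  lift S to Finset V using S.toFinite
  rw [Set.ncard_coe_finset, hDk] at hSk
  have h := two_mul_card_le_of_isDirLDSet hS (d := G.maxDegree) fun w => by
    refine le_trans ?_ (G.degree_le_maxDegree w)
    rw [← G.card_neighborFinset_eq_degree, ← Set.ncard_coe_finset]
    exact Set.ncard_le_ncard fun u hu => by simpa using hD.1 w u hu
  rw [hSk] at h
  rw [div_le_iff₀ (by positivity)]
  exact_mod_cast h
end

section
/- Let T be a tree of order n ≥ 2. Then γ_LD(T) ≤ (n + ℓ(T) − s(T) − sl(T))/2, where ℓ(T), s(T) and sl(T) denote the numbers of leaves, support vertices and support links of T, respectively. -/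
open SimpleGraph

/-- The set of leaves (vertices of degree 1) of `G`. -/
def leafSet {V : Type*} (G : SimpleGraph V) : Set V :=
  {v | (G.neighborSet v).ncard = 1}

/-- The set of support vertices (vertices adjacent to a leaf) of `G`. -/
def supportSet {V : Type*} (G : SimpleGraph V) : Set V :=
  {v | ∃ u, G.Adj v u ∧ u ∈ leafSet G}

/-- The set of support links of `G`: non-leaf, non-support vertices all of
whose neighbours are support vertices. -/
def supportLinkSet {V : Type*} (G : SimpleGraph V) : Set V :=
  {v | v ∉ leafSet G ∧ v ∉ supportSet G ∧ ∀ u, G.Adj v u → u ∈ supportSet G}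

theorem gammaLD_le_ncard {V : Type*} {G : SimpleGraph V} {S : Set V} (hS : IsLDSet G S) :
    gammaLD G ≤ S.ncard :=
  Nat.sInf_le ⟨S, hS, rfl⟩

theorem eq_of_adj_of_mem_leafSet {V : Type*} {G : SimpleGraph V} {v x y : V}
    (hv : v ∈ leafSet G) (hx : G.Adj v x) (hy : G.Adj v y) : x = y := by
  obtain ⟨z, hz⟩ := Set.ncard_eq_one.mp hv
  have hx' : x ∈ G.neighborSet v := hx
  have hy' : y ∈ G.neighborSet v := hy
  rw [hz] at hx' hy'
  exact hx'.trans hy'.symm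

theorem SimpleGraph.IsAcyclic.eq_of_adj_of_adj {V : Type*} {G : SimpleGraph V}
    (hG : G.IsAcyclic) {a b x y : V} (hab : a ≠ b) (hax : G.Adj a x) (hxb : G.Adj x b)
    (hay : G.Adj a y) (hyb : G.Adj y b) : x = y := by
  have h := (hG.subsingleton_path a b).elim
    ⟨.cons hax (.cons hxb .nil), by simp [hax.ne, hab, hxb.ne]⟩
    ⟨.cons hay (.cons hyb .nil), by simp [hay.ne, hab, hyb.ne]⟩
  simpa using congrArg (fun p => p.1.support) h

/-- If two leaves of a connected graph are adjacent, every vertex is one of them. -/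
theorem SimpleGraph.Connected.eq_or_eq_of_adj_leaves {V : Type*} {G : SimpleGraph V}
    (hG : G.Connected) {u v : V} (huv : G.Adj u v) (hu : u ∈ leafSet G) (hv : v ∈ leafSet G)
    (w : V) : w = u ∨ w = v := by
  have h := (reachable_iff_reflTransGen u w).mp (hG.preconnected u w)
  induction h with
  | refl => exact .inl rfl
  | tail _ hadj ih =>
    rcases ih with rfl | rfl
    · exact .inr (eq_of_adj_of_mem_leafSet hu hadj huv)
    · exact .inl (eq_of_adj_of_mem_leafSet hv hadj huv.symm)

/-- The vertices of colour `b` that are neither leaves, support vertices nor support links. -/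
def innerColorSet {V : Type*} (G : SimpleGraph V) (c : G.Coloring Bool) (b : Bool) : Set V :=
  {v | v ∉ leafSet G ∧ v ∉ supportSet G ∧ v ∉ supportLinkSet G ∧ c v = b}

/-- All support vertices, all leaves except one per support vertex, and one colour class of the
remaining vertices that are not support links form a locating-dominating set. -/
theorem isLDSet_support_union_leaf_diff_union_innerColorSet {V : Type*} [Finite V] [Nontrivial V]
    {G : SimpleGraph V} (hG : G.IsTree) (c : G.Coloring Bool) (b : Bool) {f : V → V}
    (hf : ∀ v ∈ supportSet G, G.Adj v (f v) ∧ f v ∈ leafSet G) :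
    IsLDSet G (supportSet G ∪ (leafSet G \ f '' supportSet G) ∪ innerColorSet G c b) := by
  set S := supportSet G ∪ (leafSet G \ f '' supportSet G) ∪ innerColorSet G c b
  have leaf : ∀ u ∉ S, u ∈ leafSet G → ∃ p ∈ supportSet G, f p = u := by
    intro u hu hl
    by_contra h
    exact hu (.inl (.inr ⟨hl, h⟩))
  have inner : ∀ u ∉ S, u ∉ leafSet G → ∀ w, G.Adj u w → w ∈ S := by
    intro u hu hl w huw
    have hup : u ∉ supportSet G := fun h => hu (.inl (.inl h))
    by_cases hw : w ∈ supportSet G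
    · exact .inl (.inl hw)
    · have hcw : c u ≠ c w := c.valid huw
      have hcu : c u ≠ b := fun h =>
        hu (.inr ⟨hl, hup, fun hk => hw (hk.2.2 w huw), h⟩)
      refine .inr ⟨fun h => hup ⟨w, huw, h⟩, hw, fun hk => hup (hk.2.2 u huw.symm), ?_⟩
      cases b <;> simp_all
  have sep : ∀ u ∉ S, ∀ v, u ≠ v → u ∉ leafSet G →
      G.neighborSet u ∩ S ≠ G.neighborSet v ∩ S := by
    intro u hu v huv hl h
    have hpos : 1 < (G.neighborSet u).ncard := by
      obtain ⟨w, hw⟩ := hG.connected.preconnected.exists_adj_of_nontrivial u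
      have h0 : 0 < (G.neighborSet u).ncard := (Set.ncard_pos).mpr ⟨w, hw⟩
      have h1 : (G.neighborSet u).ncard ≠ 1 := hl
      omega
    obtain ⟨x, y, hx, hy, hxy⟩ := (Set.one_lt_ncard_iff).mp hpos
    have hvx : x ∈ G.neighborSet v ∩ S := h ▸ ⟨hx, inner u hu hl x hx⟩
    have hvy : y ∈ G.neighborSet v ∩ S := h ▸ ⟨hy, inner u hu hl y hy⟩
    exact hxy (hG.isAcyclic.eq_of_adj_of_adj huv hx hvx.1.symm hy hvy.1.symm)
  refine ⟨fun u hu => ?_, fun u hu v hv huv h => ?_⟩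
  · by_cases hl : u ∈ leafSet G
    · obtain ⟨p, hp, rfl⟩ := leaf u hu hl
      exact ⟨p, (hf p hp).1.symm, .inl (.inl hp)⟩
    · obtain ⟨w, hw⟩ := hG.connected.preconnected.exists_adj_of_nontrivial u
      exact ⟨w, hw, inner u hu hl w hw⟩
  · by_cases hlu : u ∈ leafSet G
    · by_cases hlv : v ∈ leafSet G
      · obtain ⟨p, hp, rfl⟩ := leaf u hu hlu
        obtain ⟨q, hq, rfl⟩ := leaf v hv hlv
        have hpq : p ∈ G.neighborSet (f q) ∩ S := h ▸ ⟨(hf p hp).1.symm, .inl (.inl hp)⟩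
        exact huv (congrArg f (eq_of_adj_of_mem_leafSet hlv hpq.1 (hf q hq).1.symm))
      · exact sep v hv u huv.symm hlv h.symm
    · exact sep u hu v huv hlu h

theorem ncard_add_innerColorSet_le {V : Type*} [Fintype V] {G : SimpleGraph V}
    (c : G.Coloring Bool) (h : Disjoint (leafSet G) (supportSet G)) :
    (leafSet G).ncard + (supportSet G).ncard + (supportLinkSet G).ncard +
      (innerColorSet G c true).ncard + (innerColorSet G c false).ncard ≤ Fintype.card V := by
  rw [← Set.ncard_union_eq h, ← Set.ncard_union_eq, ← Set.ncard_union_eq, ← Set.ncard_union_eq,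
    ← Nat.card_eq_fintype_card]
  · exact Set.ncard_le_card _
  all_goals
    rw [Set.disjoint_left]
    simp only [Set.mem_union, supportLinkSet, innerColorSet, Set.mem_ofPred_eq]
    grind

/-- for a tree `T` of order `n ≥ 2`,
`γ_LD(T) ≤ (n + ℓ(T) - s(T) - sl(T)) / 2`. -/
theorem stmt7 {V : Type*} [Fintype V] (T : SimpleGraph V) (hT : T.IsTree)
    (hn : 2 ≤ Fintype.card V) :
    2 * (gammaLD T : ℤ) ≤ (Fintype.card V : ℤ) + (leafSet T).ncard
      - (supportSet T).ncard - (supportLinkSet T).ncard := by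
  have : Nontrivial V := Fintype.one_lt_card_iff_nontrivial.mp hn
  by_cases hdisj : Disjoint (leafSet T) (supportSet T)
  · have hex : ∀ v, ∃ u, v ∈ supportSet T → T.Adj v u ∧ u ∈ leafSet T := fun v => by
      by_cases hv : v ∈ supportSet T
      · obtain ⟨u, hu⟩ := hv
        exact ⟨u, fun _ => hu⟩
      · exact ⟨v, fun h => absurd h hv⟩
    choose f hf using hex
    have hinj : Set.InjOn f (supportSet T) := fun p hp q hq hpq =>
      eq_of_adj_of_mem_leafSet (hf p hp).2 (hf p hp).1.symm (hpq ▸ (hf q hq).1.symm)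
    have himage := hinj.ncard_image
    have hsub : f '' supportSet T ⊆ leafSet T := by
      rintro _ ⟨p, hp, rfl⟩
      exact (hf p hp).2
    have hdiff := Set.ncard_sdiff_add_ncard_of_subset hsub
    have c : T.Coloring Bool := hT.isAcyclic.colorable_two.toColoring (by simp)
    have hle (b : Bool) : gammaLD T ≤ (leafSet T).ncard + (innerColorSet T c b).ncard := by
      have h₁ := gammaLD_le_ncard
        (isLDSet_support_union_leaf_diff_union_innerColorSet hT c b hf)
      have h₂ := Set.ncard_union_le (supportSet T ∪ (leafSet T \ f '' supportSet T))
        (innerColorSet T c b)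
      have h₃ := Set.ncard_union_le (supportSet T) (leafSet T \ f '' supportSet T)
      omega
    have htrue := hle true
    have hfalse := hle false
    have hcard := ncard_add_innerColorSet_le c hdisj
    omega
  · obtain ⟨v, hv, u, hvu, hu⟩ := Set.not_disjoint_iff.mp hdisj
    have hall := hT.connected.eq_or_eq_of_adj_leaves hvu hv hu
    have hleaf (w : V) : w ∈ leafSet T := by
      rcases hall w with rfl | rfl <;> assumption
    have hLD : IsLDSet T {v} := by
      refine ⟨fun w hw => ?_, fun w hw x hx hwx => ?_⟩
      · obtain rfl := (hall w).resolve_left hw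
        exact ⟨v, hvu.symm, rfl⟩
      · exact absurd (((hall w).resolve_left hw).trans ((hall x).resolve_left hx).symm) hwx
    have hle := gammaLD_le_ncard hLD
    have hlink : supportLinkSet T = ∅ :=
      Set.eq_empty_of_forall_notMem fun w hw => hw.1 (hleaf w)
    have hsupp : (supportSet T).ncard ≤ (leafSet T).ncard :=
      Set.ncard_le_ncard fun w _ => hleaf w
    rw [Set.ncard_singleton] at hle
    rw [hlink, Set.ncard_empty]
    omega
end

section
/- Let G be a graph on n vertices that has a Hamiltonian path. Then γ⃗_LD(G) ≤ ⌈2n/5⌉. -/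
open SimpleGraph

/-- The path positions chosen for the locating-dominating set of a path on `n` vertices. -/
def IsChosenPos (n i : ℕ) : Prop :=
  i % 5 = 1 ∨ i % 5 = 3 ∨ (i + 1 = n ∧ n % 5 ≠ 0)

instance (n : ℕ) : DecidablePred (IsChosenPos n) := fun _ => by
  unfold IsChosenPos; infer_instance

/-- Positions `i` and `j` are consecutive and lie in the same block of five. -/
def BlockAdj (i j : ℕ) : Prop :=
  (i + 1 = j ∨ j + 1 = i) ∧ i / 5 = j / 5

/-- The orientation rule on positions: from a chosen position to an unchosen one exactly along
`BlockAdj`, and by increasing position when both or neither are chosen. -/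
def PosArc (n i j : ℕ) : Prop :=
  (IsChosenPos n i ∧ ¬ IsChosenPos n j ∧ BlockAdj i j) ∨
  (¬ IsChosenPos n i ∧ IsChosenPos n j ∧ ¬ BlockAdj j i) ∨
  ((IsChosenPos n i ↔ IsChosenPos n j) ∧ i < j)

lemma posArc_iff_not {n i j : ℕ} (h : i ≠ j) : PosArc n i j ↔ ¬ PosArc n j i := by
  have h1 : i < j ↔ ¬ j < i := by omega
  unfold PosArc
  grind

lemma posArc_of_chosen {n i j : ℕ} (hi : IsChosenPos n i) (hj : ¬ IsChosenPos n j) :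
    PosArc n i j ↔ BlockAdj i j := by
  unfold PosArc
  tauto

lemma exists_chosen_blockAdj {n j : ℕ} (hj : j < n) (h : ¬ IsChosenPos n j) :
    ∃ i < n, IsChosenPos n i ∧ BlockAdj i j := by
  unfold IsChosenPos at *
  unfold BlockAdj
  by_cases h4 : j % 5 = 4
  · exact ⟨j - 1, by omega, by omega, by omega⟩
  · exact ⟨j + 1, by omega, by omega, by omega⟩

lemma eq_of_chosen_blockAdj_iff {n j k : ℕ} (hj : j < n) (hk : k < n)
    (hj' : ¬ IsChosenPos n j) (hk' : ¬ IsChosenPos n k)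
    (h : ∀ i < n, IsChosenPos n i → (BlockAdj i j ↔ BlockAdj i k)) : j = k := by
  unfold IsChosenPos BlockAdj at *
  have hj5 : j % 5 = 0 ∨ j % 5 = 2 ∨ j % 5 = 4 := by omega
  have hk5 : k % 5 = 0 ∨ k % 5 = 2 ∨ k % 5 = 4 := by omega
  rcases hj5 with hj5 | hj5 | hj5 <;> rcases hk5 with hk5 | hk5 | hk5
  · have := h (j + 1) (by omega) (by omega); omega
  · have := h (k + 1) (by omega) (by omega); omega
  · have := h (j + 1) (by omega) (by omega); omega
  · have := h (j + 1) (by omega) (by omega); omega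
  · have := h (j + 1) (by omega) (by omega); omega
  · have := h (j - 1) (by omega) (by omega); omega
  · have := h (j - 1) (by omega) (by omega); omega
  · have := h (k - 1) (by omega) (by omega); omega
  · have := h (j - 1) (by omega) (by omega); omega

lemma card_filter_mod_five (m : ℕ) :
    ((Finset.range m).filter fun i => i % 5 = 1 ∨ i % 5 = 3).card = (m + 3) / 5 + (m + 1) / 5 := by
  induction m with
  | zero => simp
  | succ m ih =>
    rw [Finset.range_add_one, Finset.filter_insert]
    split_ifs with h
    · rw [Finset.card_insert_of_notMem (by simp), ih]; omega
    · rw [ih]; omega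

lemma five_mul_card_chosen_le (n : ℕ) :
    5 * ((Finset.range n).filter (IsChosenPos n)).card ≤ 2 * n + 4 := by
  cases n with
  | zero => simp
  | succ m =>
    have h0 : (Finset.range m).filter (IsChosenPos (m + 1)) =
        (Finset.range m).filter fun i => i % 5 = 1 ∨ i % 5 = 3 := by
      refine Finset.filter_congr fun i hi => ?_
      rw [Finset.mem_range] at hi
      unfold IsChosenPos
      omega
    rw [Finset.range_add_one, Finset.filter_insert, h0]
    have h1 := card_filter_mod_five m
    split_ifs with h
    · rw [Finset.card_insert_of_notMem (by simp), h1]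
      unfold IsChosenPos at h
      omega
    · rw [h1]
      unfold IsChosenPos at h
      omega

/-- if `G` (on `n` vertices) has a Hamiltonian path, then
`γ⃗_LD(G) ≤ ⌈2n / 5⌉`. -/
theorem stmt8 {V : Type*} [Fintype V] (G : SimpleGraph V)
    (hham : ∃ (a b : V) (p : G.Walk a b), p.IsPath ∧ ∀ v : V, v ∈ p.support) :
    lowerDirLD G ≤ ⌈(2 * (Fintype.card V : ℚ)) / 5⌉₊ := by
  classical
  obtain ⟨a, b, p, hp, hall⟩ := hham
  have hcard : Fintype.card V = p.length + 1 :=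
    (SimpleGraph.Walk.IsHamiltonian.length_support
      (hp.isHamiltonian_of_mem hall)).symm.trans p.length_support
  set n := Fintype.card V
  have hex : ∀ v, ∃ i, p.getVert i = v ∧ i ≤ p.length := fun v =>
    SimpleGraph.Walk.mem_support_iff_exists_getVert.mp (hall v)
  choose pos hpos hle using hex
  have hlt : ∀ v, pos v < n := fun v => by have := hle v; omega
  have hinj : ∀ u v, pos u = pos v → u = v := fun u v h => by rw [← hpos u, h, hpos]
  have hget : ∀ i < n, pos (p.getVert i) = i := fun i hi =>
    hp.getVert_injOn (hle _) (show i ≤ p.length by omega) (hpos _)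
  have hadj : ∀ u v, BlockAdj (pos u) (pos v) → G.Adj u v := by
    rintro u v ⟨h | h, -⟩
    · have := p.adj_getVert_succ (i := pos u) (by have := hlt v; omega)
      rwa [h, hpos, hpos] at this
    · have := p.adj_getVert_succ (i := pos v) (by have := hlt u; omega)
      rw [h, hpos, hpos] at this
      exact this.symm
  let D : V → V → Prop := fun u v => G.Adj u v ∧ PosArc n (pos u) (pos v)
  let S : Set V := {v | IsChosenPos n (pos v)}
  have hD : IsOrientation G D := by
    refine ⟨fun u v h => h.1, fun u v h => ?_⟩
    have := posArc_iff_not (n := n) fun e => h.ne (hinj u v e)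
    simp only [D, h, h.symm, true_and, this]
  have harc : ∀ u ∈ S, ∀ v ∉ S, (D u v ↔ BlockAdj (pos u) (pos v)) := fun u hu v hv =>
    ⟨fun h => (posArc_of_chosen hu hv).1 h.2, fun h => ⟨hadj u v h, (posArc_of_chosen hu hv).2 h⟩⟩
  have hmem : ∀ i < n, IsChosenPos n i → p.getVert i ∈ S := fun i hi h => by
    simpa only [S, Set.mem_ofPred_eq, hget i hi] using h
  have hS : IsDirLDSet D S := by
    refine ⟨fun v hv => ?_, fun u hu v hv huv heq => huv (hinj u v ?_)⟩
    · obtain ⟨i, hi, hc, hb⟩ := exists_chosen_blockAdj (hlt v) hv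
      refine ⟨p.getVert i, (harc _ (hmem i hi hc) v hv).2 ?_, hmem i hi hc⟩
      rwa [hget i hi]
    · refine eq_of_chosen_blockAdj_iff (hlt u) (hlt v) hu hv fun i hi hc => ?_
      have hi' := hmem i hi hc
      have h := Set.ext_iff.1 heq (p.getVert i)
      simp only [Set.mem_inter_iff, Set.mem_ofPred_eq, hi', and_true, harc _ hi' u hu,
        harc _ hi' v hv, hget i hi] at h
      exact h
  have hScard : S.ncard ≤ ((Finset.range n).filter (IsChosenPos n)).card := by
    rw [← Set.ncard_coe_finset]
    refine Set.ncard_le_ncard_of_injOn pos (fun v hv => ?_) (fun u _ v _ h => hinj u v h)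
    simpa using ⟨hlt v, hv⟩
  calc lowerDirLD G ≤ gammaLDdir D := Nat.sInf_le ⟨D, hD, rfl⟩
    _ ≤ S.ncard := Nat.sInf_le ⟨S, hS, rfl⟩
    _ ≤ _ := hScard
    _ ≤ ⌈(2 * (n : ℚ)) / 5⌉₊ := by
      have h1 := five_mul_card_chosen_le n
      have h2 : 2 * n ≤ 5 * ⌈(2 * (n : ℚ)) / 5⌉₊ := by
        have := Nat.le_ceil ((2 * (n : ℚ)) / 5)
        rw [div_le_iff₀ (by norm_num)] at this
        rw [mul_comm 5]
        exact_mod_cast this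
      omega
end

section
/- For every positive integer k there exists a constant c > 0 such that, for every graph G on n vertices with minimum degree δ ≥ 2 and maximum degree Δ satisfying Δ ≤ δ^k, one has γ⃗_LD(G) ≤ c · (log₂ δ / δ) · n. -/
open SimpleGraph

open Finset in
/-- Select each element independently with probability `p`: the multiplicative statistic
`∏ i ∈ S, f i` of the random set `S` has expectation `∏ i, (p * f i + (1 - p))`. -/
theorem sum_weight_mul_prod {V : Type*} [Fintype V] [DecidableEq V] (p : ℝ) (f : V → ℝ) :
    ∑ S : Finset V, ((∏ _i ∈ S, p) * ∏ _i ∈ univ \ S, (1 - p)) * ∏ i ∈ S, f i =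
      ∏ i, (p * f i + (1 - p)) := by
  rw [Finset.prod_add, powerset_univ]
  refine sum_congr rfl fun S _ => ?_
  rw [prod_mul_distrib]
  ring

open Finset in
/-- Select each element independently with probability `p`: a given element is selected
with probability `p`. -/
theorem sum_weight_mul_mem {V : Type*} [Fintype V] [DecidableEq V] (p : ℝ) (v : V) :
    ∑ S : Finset V, ((∏ _i ∈ S, p) * ∏ _i ∈ univ \ S, (1 - p)) * (if v ∈ S then 1 else 0) =
      p := by
  have h := Finset.prod_add (fun _ : V => p) (fun i => if i = v then 0 else 1 - p) univ
  have hl : ∏ i : V, (p + if i = v then 0 else 1 - p) = p := by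
    rw [prod_eq_single v] <;> simp +contextual
  rw [hl, powerset_univ] at h
  conv_rhs => rw [h]
  refine sum_congr rfl fun S _ => ?_
  by_cases hv : v ∈ S
  · rw [if_pos hv, mul_one]
    congr 1
    refine prod_congr rfl fun i hi => ?_
    rw [if_neg]
    rintro rfl
    exact (mem_sdiff.mp hi).2 hv
  · rw [if_neg hv, mul_zero, prod_eq_zero (i := v) (s := univ \ S) (by simp [hv]) (by simp),
      mul_zero]

open Finset in
/-- Every graph has a small set that contains at least `d` neighbours of each vertex
outside it. -/
theorem exists_multiple_dominating_set {V : Type*} [Fintype V] [DecidableEq V]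
    (G : SimpleGraph V) [DecidableRel G.Adj] (d : ℕ) {p : ℝ} (hp0 : 0 < p) (hp1 : p < 1) :
    ∃ S : Finset V, (∀ u ∉ S, d ≤ #(G.neighborFinset u ∩ S)) ∧
      (#S : ℝ) ≤ (p + 2 ^ d * Real.exp (-(p * G.minDegree / 2))) * Fintype.card V := by
  set w : Finset V → ℝ := fun S => (∏ _i ∈ S, p) * ∏ _i ∈ univ \ S, (1 - p) with hw
  have hwpos : ∀ S, 0 < w S := fun S =>
    mul_pos (prod_pos fun _ _ => hp0) (prod_pos fun _ _ => sub_pos.mpr hp1)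
  have hwsum : ∑ S, w S = 1 := by
    have := sum_weight_mul_prod p (fun _ : V => (1 : ℝ))
    simpa [hw] using this
  set g : V → V → ℝ := fun u i => if i ∈ G.neighborFinset u then 1 / 2 else 1 with hg
  set F : Finset V → ℝ := fun S =>
    ∑ v : V, (if v ∈ S then (1 : ℝ) else 0) + ∑ u : V, 2 ^ d * ∏ i ∈ S, g u i with hF
  set B : ℝ := (p + 2 ^ d * Real.exp (-(p * G.minDegree / 2))) * Fintype.card V with hB
  have hbound : ∀ u, ∑ S, w S * ∏ i ∈ S, g u i ≤ Real.exp (-(p * G.minDegree / 2)) := by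
    intro u
    rw [sum_weight_mul_prod]
    have h1 : ∀ i, p * g u i + (1 - p) = if i ∈ G.neighborFinset u then 1 - p / 2 else 1 := by
      intro i
      simp only [hg]
      split_ifs <;> ring
    simp only [h1]
    rw [prod_ite_mem, univ_inter, prod_const, card_neighborFinset_eq_degree]
    calc (1 - p / 2) ^ G.degree u ≤ (Real.exp (-(p / 2))) ^ G.degree u := by
          gcongr
          · linarith
          · exact Real.one_sub_le_exp_neg _
      _ = Real.exp (-(p * G.degree u / 2)) := by
          rw [← Real.exp_nat_mul]
          ring_nf
      _ ≤ _ := by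
          gcongr
          exact G.minDegree_le_degree u
  have hexp : ∑ S, w S * F S ≤ B := by
    calc ∑ S, w S * F S
        = ∑ v : V, ∑ S, w S * (if v ∈ S then 1 else 0) +
            ∑ u : V, 2 ^ d * ∑ S, w S * ∏ i ∈ S, g u i := by
          simp only [hF, mul_add, sum_add_distrib, mul_sum]
          congr 1
          · exact sum_comm
          · rw [sum_comm]
            exact sum_congr rfl fun _ _ => sum_congr rfl fun _ _ => by ring
      _ ≤ ∑ _v : V, p + ∑ _u : V, 2 ^ d * Real.exp (-(p * G.minDegree / 2)) := by
          gcongr with v _ u _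
          · exact (sum_weight_mul_mem p v).le
          · exact hbound u
      _ = B := by
          simp only [sum_const, card_univ, nsmul_eq_mul, hB]
          ring
  obtain ⟨S, -, hS⟩ : ∃ S ∈ (univ : Finset (Finset V)), w S * F S ≤ w S * B := by
    refine exists_le_of_sum_le univ_nonempty ?_
    rwa [← sum_mul, hwsum, one_mul]
  have hFS : F S ≤ B := le_of_mul_le_mul_left hS (hwpos S)
  refine ⟨S ∪ univ.filter fun u => #(G.neighborFinset u ∩ S) < d, fun u hu => ?_, ?_⟩
  · simp only [mem_union, mem_filter, mem_univ, true_and, not_or, not_lt] at hu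
    exact hu.2.trans (card_le_card (inter_subset_inter_left subset_union_left))
  · refine le_trans ?_ hFS
    refine (Nat.cast_le.mpr (card_union_le _ _)).trans ?_
    rw [Nat.cast_add, card_filter, Nat.cast_sum]
    simp only [hF]
    gcongr with u _
    · simp
    · have hprod : ∏ i ∈ S, g u i = (1 / 2) ^ #(G.neighborFinset u ∩ S) := by
        simp only [hg]
        rw [prod_ite_mem, prod_const, inter_comm]
      rw [hprod]
      split_ifs with h
      · rw [one_div, inv_pow, ← div_eq_mul_inv, Nat.cast_one, one_le_div (by positivity)]
        exact pow_le_pow_right₀ (by norm_num) h.le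
      · simp only [Nat.cast_zero]
        positivity

open Finset in
/-- If each vertex outside `S` has so many neighbours in `S` that the subsets of these outnumber
the maximum degree, then distinct nonempty sets of neighbours in `S` can be chosen for the
vertices outside `S`. -/
theorem exists_injective_neighbor_subset {V : Type*} [Fintype V] [DecidableEq V]
    (G : SimpleGraph V) [DecidableRel G.Adj] {d : ℕ} (hpos : 0 < G.maxDegree)
    (hd : G.maxDegree < 2 ^ d) (S : Finset V)
    (hS : ∀ u ∉ S, d ≤ #(G.neighborFinset u ∩ S)) :
    ∃ f : {u // u ∉ S} → Finset V, Function.Injective f ∧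
      ∀ u, (f u).Nonempty ∧ f u ⊆ G.neighborFinset u ∩ S := by
  set t : {u // u ∉ S} → Finset (Finset V) := fun u =>
    (G.neighborFinset u ∩ S).powerset.erase ∅ with ht
  obtain ⟨f, hf, hft⟩ := (all_card_le_biUnion_card_iff_exists_injective t).mp fun s => by
    refine Nat.le_of_mul_le_mul_right
      (card_mul_le_card_mul (fun u X => X ∈ t u) (m := G.maxDegree) (n := G.maxDegree) ?_ ?_) hpos
    · intro u hu
      have : bipartiteAbove (fun u X => X ∈ t u) (s.biUnion t) u = t u := by
        ext X
        simp only [mem_bipartiteAbove, mem_biUnion, and_iff_right_iff_imp]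
        exact fun hX => ⟨u, hu, hX⟩
      rw [this, ht, card_erase_of_mem (empty_mem_powerset _), card_powerset]
      have := Nat.pow_le_pow_right two_pos (hS u u.2)
      omega
    · intro X hX
      obtain ⟨v, -, hXv⟩ := mem_biUnion.mp hX
      obtain ⟨x, hx⟩ := nonempty_iff_ne_empty.mpr (mem_erase.mp hXv).1
      refine le_trans ?_ (G.degree_le_maxDegree x)
      rw [← card_neighborFinset_eq_degree]
      refine card_le_card_of_injOn Subtype.val (fun u hu => ?_) Subtype.val_injective.injOn
      have hu := mem_powerset.mp (mem_erase.mp ((mem_bipartiteBelow _).mp hu).2).2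
      have := (mem_inter.mp (hu hx)).1
      rw [mem_neighborFinset] at this
      simpa using this.symm
  refine ⟨f, hf, fun u => ?_⟩
  obtain ⟨h1, h2⟩ := mem_erase.mp (hft u)
  exact ⟨nonempty_iff_ne_empty.mpr h1, mem_powerset.mp h2⟩

/-- Distinct nonempty sets of neighbours in `S`, one for each vertex outside `S`, are the
in-neighbourhoods within `S` of some orientation. -/
theorem lowerDirLD_le_card_of_injective {V : Type*} [LinearOrder V]
    (G : SimpleGraph V) (S : Finset V) (f : {u // u ∉ S} → Finset V)
    (hf : Function.Injective f) (hne : ∀ u, (f u).Nonempty)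
    (hsub : ∀ u, ∀ w ∈ f u, G.Adj u w ∧ w ∈ S) :
    lowerDirLD G ≤ S.card := by
  classical
  set D : V → V → Prop := fun w u => G.Adj w u ∧
    if hu : u ∈ S then (if hw : w ∈ S then w < u else u ∉ f ⟨w, hw⟩)
    else (if w ∈ S then w ∈ f ⟨u, hu⟩ else w < u) with hD
  have hor : IsOrientation G D := by
    refine ⟨fun u v h => h.1, fun u v h => ?_⟩
    have hlt : u < v ↔ ¬ v < u := by
      rw [not_lt]
      exact ⟨le_of_lt, fun hle => lt_of_le_of_ne hle h.ne⟩
    by_cases hu : u ∈ S <;> by_cases hv : v ∈ S <;> simp [hD, hu, hv, h, h.symm, hlt]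
  have hin : ∀ u (hu : u ∉ S), {w | D w u} ∩ (S : Set V) = f ⟨u, hu⟩ := by
    intro u hu
    ext w
    simp only [hD, Set.mem_inter_iff, Set.mem_ofPred_eq, Finset.mem_coe, hu, dif_neg,
      not_false_eq_true]
    constructor
    · rintro ⟨⟨-, h⟩, hw⟩
      rwa [if_pos hw] at h
    · intro h
      obtain ⟨h1, h2⟩ := hsub ⟨u, hu⟩ w h
      exact ⟨⟨h1.symm, by rwa [if_pos h2]⟩, h2⟩
  have hLD : IsDirLDSet D (S : Set V) := by
    refine ⟨fun u hu => ?_, fun u hu v hv huv => ?_⟩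
    · rw [hin u hu]
      exact hne _
    · rw [hin u hu, hin v hv]
      intro h
      exact huv (congrArg Subtype.val (hf (Finset.coe_injective h)))
  calc lowerDirLD G ≤ gammaLDdir D := Nat.sInf_le ⟨D, hor, rfl⟩
    _ ≤ S.card := Nat.sInf_le ⟨S, hLD, Set.ncard_coe_finset S⟩

open Finset in
theorem lowerDirLD_le_card_s9 {V : Type*} [Fintype V] [LinearOrder V]
    (G : SimpleGraph V) [DecidableRel G.Adj] {d : ℕ} (hpos : 0 < G.maxDegree)
    (hd : G.maxDegree < 2 ^ d) (S : Finset V)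
    (hS : ∀ u ∉ S, d ≤ #(G.neighborFinset u ∩ S)) :
    lowerDirLD G ≤ #S := by
  obtain ⟨f, hf, h⟩ := exists_injective_neighbor_subset G hpos hd S hS
  refine lowerDirLD_le_card_of_injective G S f hf (fun u => (h u).1) fun u w hw => ?_
  simpa using (h u).2 hw

/-- for every positive integer `k` there is a constant `c > 0`
such that every graph `G` on `n` vertices with minimum degree `δ ≥ 2` and
maximum degree `Δ ≤ δ ^ k` satisfies `γ⃗_LD(G) ≤ c * (log₂ δ / δ) * n`. -/
theorem stmt9 (k : ℕ) (hk : 0 < k) :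
    ∃ c : ℝ, 0 < c ∧
      ∀ (n : ℕ) (G : SimpleGraph (Fin n)) [DecidableRel G.Adj],
        2 ≤ G.minDegree → G.maxDegree ≤ G.minDegree ^ k →
        (lowerDirLD G : ℝ) ≤
          c * (Real.logb 2 (G.minDegree : ℝ) / (G.minDegree : ℝ)) * n := by
  refine ⟨4 * k + 6, by positivity, fun n G _ h2 hΔ => ?_⟩
  set δ := G.minDegree with hδ
  set L := Nat.log 2 δ + 1 with hL
  have hδL : δ < 2 ^ L := Nat.lt_pow_succ_log_self one_lt_two δ
  have hδ0 : (0 : ℝ) < δ := by exact_mod_cast (by omega : 0 < δ)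
  have hlog1 : 1 ≤ Nat.log 2 δ := Nat.log_pos one_lt_two h2
  have hlog : (Nat.log 2 δ : ℝ) ≤ Real.logb 2 δ := Real.natLog_le_logb δ 2
  have hLlog : (L : ℝ) ≤ 2 * Real.logb 2 δ := by
    have : (1 : ℝ) ≤ Nat.log 2 δ := by exact_mod_cast hlog1
    rw [hL]
    push_cast
    linarith
  have hL1 : (1 : ℝ) ≤ L := by
    rw [hL]
    push_cast
    linarith [Nat.cast_nonneg (α := ℝ) (Nat.log 2 δ)]
  have hd : G.maxDegree < 2 ^ (L * k) := by
    rw [pow_mul]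
    exact hΔ.trans_lt (Nat.pow_lt_pow_left hδL hk.ne')
  have hpos : 0 < G.maxDegree := lt_of_lt_of_le (by omega) G.minDegree_le_maxDegree
  have hkey : (2 * (k + 1) * L + 1) / δ ≤ (4 * k + 6) * (Real.logb 2 δ / δ) := by
    rw [← mul_div_assoc]
    gcongr
    nlinarith [Nat.cast_nonneg (α := ℝ) k]
  rcases lt_or_ge (2 * ((k : ℝ) + 1) * L / δ) 1 with hp | hp
  · obtain ⟨S, hS, hcard⟩ :=
      exists_multiple_dominating_set G (L * k) (p := 2 * (k + 1) * L / δ) (by positivity) hp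
    have hexp : (2 : ℝ) ^ (L * k) * Real.exp (-(2 * (k + 1) * L / δ * δ / 2)) ≤ 1 / δ := by
      have he : ∀ m : ℕ, (2 : ℝ) ^ m ≤ Real.exp m := fun m => by
        rw [← Real.exp_one_pow]
        gcongr
        linarith [Real.add_one_le_exp 1]
      have h3 : (δ : ℝ) ≤ Real.exp L := le_trans (by exact_mod_cast hδL.le) (he L)
      have h4 : Real.exp (-(2 * (k + 1) * L / δ * δ / 2)) =
          (Real.exp ((L * k : ℕ) : ℝ) * Real.exp L)⁻¹ := by
        rw [← Real.exp_add, ← Real.exp_neg, div_mul_cancel₀ _ hδ0.ne']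
        push_cast
        ring_nf
      rw [h4, ← div_eq_mul_inv, div_le_div_iff₀ (by positivity) hδ0, one_mul]
      exact mul_le_mul (he _) h3 hδ0.le (Real.exp_pos _).le
    rw [Fintype.card_fin] at hcard
    calc (lowerDirLD G : ℝ) ≤ S.card := by
          exact_mod_cast lowerDirLD_le_card_s9 G hpos hd S hS
      _ ≤ _ := hcard
      _ ≤ _ := by
          gcongr
          refine le_trans (add_le_add_right hexp _) ?_
          rwa [← add_div]
  · calc (lowerDirLD G : ℝ) ≤ (Finset.univ : Finset (Fin n)).card := by
          exact_mod_cast lowerDirLD_le_card_s9 G hpos hd Finset.univ (by simp)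
      _ = 1 * n := by simp
      _ ≤ _ := by
          gcongr
          refine hp.trans (le_trans ?_ hkey)
          gcongr
          linarith
end

section
/- For every positive integer d, every positive integer n₀ and every real ε > 0, there exists a twin-free graph G of minimum degree at least d and order n ≥ n₀ such that γ⃗_LD(G) ≥ (1/2 − ε)·n. -/
open SimpleGraph

/-- The graph on hubs `A` and pairs `{(i, false), (i, true)}`, `i : I`: the two vertices of a pair are
adjacent, `(i, false)` is joined to every hub and `(i, true)` to every hub except `f i`. -/
def hubGraph {A I : Type*} (f : I → A) : SimpleGraph (A ⊕ I × Bool) :=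
  SimpleGraph.fromRel fun x y =>
    match x, y with
    | .inl a, .inr (i, b) => b = false ∨ f i ≠ a
    | .inr (i, _), .inr (j, _) => i = j
    | _, _ => False

section hubGraph

variable {A I : Type*} (f : I → A)

@[simp] lemma hubGraph_inl_inl (a b : A) : ¬ (hubGraph f).Adj (.inl a) (.inl b) := by
  simp [hubGraph]

@[simp] lemma hubGraph_inl_inr (a : A) (i : I) (b : Bool) :
    (hubGraph f).Adj (.inl a) (.inr (i, b)) ↔ b = false ∨ f i ≠ a := by
  simp [hubGraph]

@[simp] lemma hubGraph_inr_inl (a : A) (i : I) (b : Bool) :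
    (hubGraph f).Adj (.inr (i, b)) (.inl a) ↔ b = false ∨ f i ≠ a := by
  simp [hubGraph]

@[simp] lemma hubGraph_inr_inr (i j : I) (b c : Bool) :
    (hubGraph f).Adj (.inr (i, b)) (.inr (j, c)) ↔ i = j ∧ b ≠ c := by
  simp only [hubGraph, SimpleGraph.fromRel_adj]
  grind

end hubGraph

lemma not_areTwins_of_separating {V : Type*} {G : SimpleGraph V} {u v w : V} (hu : w ≠ u)
    (hv : w ≠ v) (h : ¬ (G.Adj u w ↔ G.Adj v w)) : ¬ AreTwins G u v := by
  rintro (e | e)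
  · exact h (by simpa using Set.ext_iff.1 e w)
  · exact h (by simpa [hu, hv] using Set.ext_iff.1 e w)

lemma exists_separating_hubGraph {A I : Type*} [Nontrivial I] {f : I → A}
    (hf : Function.Surjective f) {x y : A ⊕ I × Bool} (hxy : x ≠ y) :
    ∃ w, w ≠ x ∧ w ≠ y ∧ ¬ ((hubGraph f).Adj x w ↔ (hubGraph f).Adj y w) := by
  rcases x with a | ⟨i, b⟩ <;> rcases y with a' | ⟨j, c⟩
  · obtain ⟨i, rfl⟩ := hf a
    exact ⟨.inr (i, true), by simp, by simp, by simpa using hxy⟩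
  · obtain ⟨k, hk⟩ := exists_ne j
    exact ⟨.inr (k, false), by simp, by simp [hk], by simp [hk.symm]⟩
  · obtain ⟨k, hk⟩ := exists_ne i
    exact ⟨.inr (k, false), by simp [hk], by simp, by simp [hk.symm]⟩
  · by_cases hij : i = j
    · subst hij
      refine ⟨.inl (f i), by simp, by simp, ?_⟩
      simpa using hxy
    · exact ⟨.inr (i, !b), by simp, by simp [hij], by simp [Ne.symm hij]⟩

lemma le_ncard_neighborSet_hubGraph {d : ℕ} {A I : Type*} [Finite A] [Finite I] (f : I → A)
    (hA : d + 1 ≤ Nat.card A) (hI : d ≤ Nat.card I) (x : A ⊕ I × Bool) :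
    d ≤ ((hubGraph f).neighborSet x).ncard := by
  rcases x with a | ⟨i, b⟩
  · have hinj : Function.Injective fun i : I => (Sum.inr (i, false) : A ⊕ I × Bool) :=
      fun i j h => by simpa using h
    calc d ≤ Nat.card I := hI
      _ = (Set.range fun i : I => (Sum.inr (i, false) : A ⊕ I × Bool)).ncard :=
        (Set.ncard_range_of_injective hinj).symm
      _ ≤ _ := Set.ncard_le_ncard (by rintro _ ⟨i, rfl⟩; simp)
  · have hcard : ({f i}ᶜ : Set A).ncard + 1 = Nat.card A := by
      have := Set.ncard_add_ncard_compl ({f i} : Set A)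
      rw [Set.ncard_singleton] at this
      omega
    calc d ≤ ({f i}ᶜ : Set A).ncard := by omega
      _ = (Sum.inl '' ({f i}ᶜ : Set A) : Set (A ⊕ I × Bool)).ncard :=
        (Set.ncard_image_of_injective _ Sum.inl_injective).symm
      _ ≤ _ := Set.ncard_le_ncard (by rintro _ ⟨a, ha, rfl⟩; simpa using Or.inr (Ne.symm ha))

/-- At most `2 ^ |A|` pairs avoid a directed locating-dominating set, since the vertices of such pairs
have distinct in-neighbourhoods contained in the set of hubs. -/
lemma card_le_ncard_add_two_pow {A I : Type*} [Finite A] [Finite I] (f : I → A)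
    {D : A ⊕ I × Bool → A ⊕ I × Bool → Prop} (hD : ∀ u v, D u v → (hubGraph f).Adj u v)
    {S : Set (A ⊕ I × Bool)} (hS : IsDirLDSet D S) :
    Nat.card I ≤ S.ncard + 2 ^ Nat.card A := by
  let T : Set I := {i | ∀ b, Sum.inr (i, b) ∉ S}
  have hT : T.ncard ≤ 2 ^ Nat.card A := by
    rw [← Set.ncard_univ A, ← Set.ncard_powerset, Set.powerset_univ]
    refine Set.ncard_le_ncard_of_injOn
      (fun i => {a | D (.inl a) (.inr (i, false)) ∧ Sum.inl a ∈ S}) (by simp) ?_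
    intro i hi j hj hij
    by_contra hne
    refine hS.2 _ (hi false) _ (hj false) (by simpa using hne) ?_
    ext (a | ⟨k, b⟩)
    · exact Set.ext_iff.1 hij a
    · refine ⟨fun ⟨h, hk⟩ => ?_, fun ⟨h, hk⟩ => ?_⟩
      · obtain ⟨rfl, -⟩ := (hubGraph_inr_inr f _ _ _ _).1 (hD _ _ h)
        exact absurd hk (hi b)
      · obtain ⟨rfl, -⟩ := (hubGraph_inr_inr f _ _ _ _).1 (hD _ _ h)
        exact absurd hk (hj b)
  have hTc : Tᶜ.ncard ≤ S.ncard := by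
    have h : ∀ i, ∃ b, i ∈ Tᶜ → Sum.inr (i, b) ∈ S := by
      intro i
      by_cases hi : i ∈ T
      · exact ⟨false, fun h => absurd hi h⟩
      · obtain ⟨b, hb⟩ := not_forall.1 hi
        exact ⟨b, fun _ => not_not.1 hb⟩
    choose b hb using h
    exact Set.ncard_le_ncard_of_injOn (fun i => Sum.inr (i, b i)) hb
      fun i _ j _ hij => by simp at hij; exact hij.1
  have := Set.ncard_add_ncard_compl T
  omega

lemma le_lowerDirLD {V : Type*} {G : SimpleGraph V} {k : ℕ}
    (h : ∀ D : V → V → Prop, (∀ u v, D u v → G.Adj u v) → ∀ S, IsDirLDSet D S → k ≤ S.ncard) :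
    k ≤ lowerDirLD G := by
  classical
  let _ := linearOrderOfSTO (α := V) WellOrderingRel
  have hne : {n | ∃ D : V → V → Prop, IsOrientation G D ∧ gammaLDdir D = n}.Nonempty := by
    refine ⟨_, fun u v => G.Adj u v ∧ u < v, ⟨fun u v h => h.1, fun u v huv => ?_⟩, rfl⟩
    have := huv.ne
    have := huv.symm
    grind
  refine le_csInf hne ?_
  rintro _ ⟨D, hD, rfl⟩
  refine le_csInf ⟨_, Set.univ, by simp [IsDirLDSet], rfl⟩ ?_
  rintro _ ⟨S, hS, rfl⟩
  exact h D hD.1 S hS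

lemma IsDirLDSet.comap {V W : Type*} (e : W ≃ V) {D : V → V → Prop} {S : Set V}
    (hS : IsDirLDSet D S) : IsDirLDSet (fun x y => D (e x) (e y)) (e ⁻¹' S) := by
  refine ⟨fun u hu => ?_, fun u hu v hv huv h => ?_⟩
  · obtain ⟨w, hw⟩ := hS.1 _ hu
    exact ⟨e.symm w, by simpa using hw⟩
  · refine hS.2 _ hu _ hv (e.injective.ne huv) ?_
    ext w
    simpa using Set.ext_iff.1 h (e.symm w)

/-- for all `d`, `n₀` and `ε > 0` there is a twin-free graph `G`
of minimum degree at least `d` and order `n ≥ n₀` with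
`γ⃗_LD(G) ≥ (1/2 - ε) n`. -/
theorem stmt10 (d n₀ : ℕ) (hd : 0 < d) (hn₀ : 0 < n₀) (ε : ℝ) (hε : 0 < ε) :
    ∃ (n : ℕ) (G : SimpleGraph (Fin n)),
      n₀ ≤ n ∧
      (∀ u v : Fin n, u ≠ v → ¬ AreTwins G u v) ∧
      (∀ v : Fin n, d ≤ (G.neighborSet v).ncard) ∧
      (1 / 2 - ε) * n ≤ (lowerDirLD G : ℝ) := by
  obtain ⟨m₀, hm₀⟩ := exists_nat_gt ((d + 1 + 2 ^ (d + 1) : ℝ) / ε)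
  let m := m₀ + n₀ + d + 2
  let f : Fin m → Fin (d + 1) := fun i => Fin.ofNat (d + 1) i
  have hf : Function.Surjective f := fun a =>
    ⟨⟨a, by have := a.isLt; omega⟩, Fin.ext (Nat.mod_eq_of_lt a.isLt)⟩
  have : Nontrivial (Fin m) := Fin.nontrivial_iff_two_le.2 (by omega)
  let e : Fin (d + 1 + m * 2) ≃ Fin (d + 1) ⊕ Fin m × Bool :=
    Fintype.equivOfCardEq (by simp)
  let G := (hubGraph f).comap e
  refine ⟨d + 1 + m * 2, G, by omega, fun u v huv => ?_, fun v => ?_, ?_⟩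
  · obtain ⟨w, hu, hv, hw⟩ := exists_separating_hubGraph hf (e.injective.ne huv)
    obtain ⟨w, rfl⟩ := e.surjective w
    exact not_areTwins_of_separating (ne_of_apply_ne e hu) (ne_of_apply_ne e hv) hw
  · have h : G.neighborSet v = e ⁻¹' (hubGraph f).neighborSet (e v) := rfl
    rw [h, Set.ncard_preimage_of_injective_subset_range e.injective (by simp)]
    exact le_ncard_neighborSet_hubGraph f (by simp) (by simp; omega) _
  · have hle : m - 2 ^ (d + 1) ≤ lowerDirLD G := by
      refine le_lowerDirLD fun D hD S hS => ?_
      have := card_le_ncard_add_two_pow f (fun u v h => by simpa [G] using hD _ _ h)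
        (hS.comap e.symm)
      rw [Set.ncard_preimage_of_injective_subset_range e.symm.injective (by simp)] at this
      simpa [add_comm] using this
    have hle' : (m : ℝ) ≤ lowerDirLD G + 2 ^ (d + 1) := by
      exact_mod_cast Nat.sub_le_iff_le_add.1 hle
    have hmε : (d + 1 + 2 ^ (d + 1) : ℝ) ≤ ε * m := by
      rw [div_lt_iff₀ hε] at hm₀
      have : (m₀ : ℝ) ≤ m := by exact_mod_cast (by omega : m₀ ≤ m)
      nlinarith
    have hdε : 0 ≤ ε * (d + 1) := by positivity
    have hpow : (0 : ℝ) < 2 ^ (d + 1) := by positivity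
    have hd0 : (0 : ℝ) ≤ d := d.cast_nonneg
    push_cast
    nlinarith
end

section
/- Let G be a graph with maximum degree Δ and let X be a subset of vertices such that every vertex v ∉ X has at least log₂ Δ + 1 neighbours in X. Then there exists an orientation D of G for which X is a locating-dominating set of D. -/
open SimpleGraph

/-- If every `v` has at least `d` candidates, and every candidate is shared by at most `d` of
the `v`, then distinct candidates can be chosen. -/
theorem exists_injective_mem_of_degree_le {ι α : Type*} [Fintype ι] [DecidableEq α]
    (t : ι → Finset α) {d : ℕ} (hd : ι → 0 < d) (hcard : ∀ i, d ≤ (t i).card)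
    (hshare : ∀ a, (Finset.univ.filter fun i => a ∈ t i).card ≤ d) :
    ∃ f : ι → α, Function.Injective f ∧ ∀ i, f i ∈ t i := by
  classical
  refine (Finset.all_card_le_biUnion_card_iff_exists_injective t).mp fun s => ?_
  rcases s.eq_empty_or_nonempty with rfl | ⟨i, -⟩
  · simp
  refine Nat.le_of_mul_le_mul_right ?_ (hd i)
  refine Finset.card_mul_le_card_mul (fun i a => a ∈ t i) (fun i hi => ?_) fun a _ => ?_
  · refine (hcard i).trans (Finset.card_le_card fun a ha => ?_)
    exact Finset.mem_filter.mpr ⟨Finset.mem_biUnion.mpr ⟨i, hi, ha⟩, ha⟩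
  · exact (Finset.card_le_card (Finset.filter_subset_filter _ (Finset.subset_univ s))).trans
      (hshare a)

/-- Numerical form of the degree hypothesis: a vertex set of size at least `log₂ d + 1` has at
least `d` nonempty subsets. -/
theorem le_two_pow_sub_one_of_logb_add_one_le {d n : ℕ} (hd : 0 < d)
    (h : Real.logb 2 (d : ℝ) + 1 ≤ (n : ℝ)) : d ≤ 2 ^ n - 1 := by
  have hd' : (0 : ℝ) < d := by exact_mod_cast hd
  have h2 : Real.logb 2 ((d : ℝ) * 2) ≤ n := by
    rwa [Real.logb_mul hd'.ne' two_ne_zero, Real.logb_self_eq_one one_lt_two]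
  rw [Real.logb_le_iff_le_rpow one_lt_two (by positivity), Real.rpow_natCast] at h2
  have h3 : d * 2 ≤ 2 ^ n := by exact_mod_cast h2
  omega

/-- Any prescription of nonempty, pairwise distinct in-neighbourhoods inside `X` for the vertices
outside `X` is realized by an orientation. -/
theorem exists_orientation_isDirLDSet {V : Type*} (G : SimpleGraph V) (X : Set V)
    (f : {v // v ∉ X} → Finset V) (hf : Function.Injective f) (hne : ∀ v, (f v).Nonempty)
    (hsub : ∀ v, ∀ w ∈ f v, G.Adj v w ∧ w ∈ X) :
    ∃ D : V → V → Prop, IsOrientation G D ∧ IsDirLDSet D X := by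
  classical
  let _ : LinearOrder V := IsWellOrder.linearOrder WellOrderingRel
  let D : V → V → Prop := fun u v => G.Adj u v ∧
    if hv : v ∈ X then (if hu : u ∈ X then u < v else v ∉ f ⟨u, hu⟩)
    else (if u ∈ X then u ∈ f ⟨v, hv⟩ else u < v)
  have hD : ∀ v : {v // v ∉ X}, {w | D w v} ∩ X = f v := by
    intro v
    ext w
    simp only [D, Set.mem_inter_iff, Set.mem_ofPred_eq, Finset.mem_coe, v.2, dite_false]
    constructor
    · rintro ⟨⟨-, h⟩, hw⟩
      simpa [hw] using h
    · intro h
      obtain ⟨hadj, hw⟩ := hsub v w h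
      exact ⟨⟨hadj.symm, by simpa [hw] using h⟩, hw⟩
  refine ⟨D, ⟨fun u v h => h.1, fun u v h => ?_⟩, fun u hu => ?_, fun u hu v hv huv heq => huv ?_⟩
  · have hlt : u < v ↔ ¬ v < u := ⟨fun h => h.asymm, fun h' => (not_lt.mp h').lt_of_ne h.ne⟩
    by_cases hu : u ∈ X <;> by_cases hv : v ∈ X <;> simp [D, hu, hv, h, h.symm, hlt]
  · simpa [hD ⟨u, hu⟩] using hne ⟨u, hu⟩
  · rw [hD ⟨u, hu⟩, hD ⟨v, hv⟩] at heq
    exact congrArg Subtype.val (hf (Finset.coe_injective heq))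

/-- if every vertex outside `X` has at least `log₂ Δ + 1`
neighbours in `X`, then `G` has an orientation for which `X` is a
locating-dominating set. -/
theorem stmt11 {V : Type*} [Fintype V] (G : SimpleGraph V)
    [DecidableRel G.Adj] (X : Set V)
    (hX : ∀ v ∉ X,
      Real.logb 2 (G.maxDegree : ℝ) + 1 ≤ ((G.neighborSet v ∩ X).ncard : ℝ)) :
    ∃ D : V → V → Prop, IsOrientation G D ∧ IsDirLDSet D X := by
  classical
  have hpos : ∀ v : {v // v ∉ X}, 0 < G.maxDegree := by
    intro v
    by_contra h0
    have h := hX v v.2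
    rw [Nat.eq_zero_of_not_pos h0, Nat.cast_zero, Real.logb_zero, zero_add] at h
    have hcard : 0 < (G.neighborSet v ∩ X).ncard := by exact_mod_cast h
    obtain ⟨w, hw, -⟩ := Set.nonempty_of_ncard_ne_zero hcard.ne'
    exact h0 (((G.degree_pos_iff_exists_adj v).mpr ⟨w, hw⟩).trans_le (G.degree_le_maxDegree v))
  let t : {v // v ∉ X} → Finset (Finset V) :=
    fun v => (G.neighborSet v ∩ X).toFinset.powerset.erase ∅
  have hmem : ∀ v b, b ∈ t v ↔ b.Nonempty ∧ ∀ w ∈ b, G.Adj v w ∧ w ∈ X := by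
    intro v b
    simp only [t, Finset.mem_erase, Finset.mem_powerset, Finset.nonempty_iff_ne_empty,
      Finset.subset_iff, Set.mem_toFinset, Set.mem_inter_iff, SimpleGraph.mem_neighborSet, ne_eq]
  obtain ⟨f, hf, hft⟩ := exists_injective_mem_of_degree_le t hpos
    (fun v => by
      rw [Finset.card_erase_of_mem (Finset.empty_mem_powerset _), Finset.card_powerset,
        ← Set.ncard_eq_toFinset_card']
      exact le_two_pow_sub_one_of_logb_add_one_le (hpos v) (hX v v.2))
    (fun b => by
      rcases b.eq_empty_or_nonempty with rfl | ⟨w, hw⟩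
      · simp [t]
      refine le_trans ?_ (G.degree_le_maxDegree w)
      refine Finset.card_le_card_of_injOn Subtype.val (fun v hv => ?_)
        Subtype.val_injective.injOn
      have hv' := ((hmem v b).mp (Finset.mem_filter.mp hv).2).2 w hw
      simpa using hv'.1.symm)
  exact exists_orientation_isDirLDSet G X f hf (fun v => ((hmem v _).mp (hft v)).1)
    fun v => ((hmem v _).mp (hft v)).2
end

section
/- Let G be a graph with maximum degree Δ ≥ 1 and let k be a positive integer with k ≥ log₂ Δ + 1. Then γ⃗_LD(G) ≤ γ_k(G), where γ_k(G) is the minimum size of a k-dominating set of G. -/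
open SimpleGraph

/-- The `k`-domination number `γ_k(G)`: minimum size of a set `S` such that
every vertex outside `S` has at least `k` neighbours in `S`. -/
noncomputable def kDomNumber {V : Type*} (G : SimpleGraph V) (k : ℕ) : ℕ :=
  sInf {m | ∃ S : Set V,
    (∀ v ∉ S, k ≤ (G.neighborSet v ∩ S).ncard) ∧ S.ncard = m}

/-- If every vertex outside `S` has at least `k` neighbours in `S`, where `Δ(G) < 2 ^ k`, then one
can choose pairwise distinct nonempty sets of neighbours in `S` for the vertices outside `S`. -/
theorem exists_injective_nonempty_subset_neighbors {V : Type*} [Fintype V] (G : SimpleGraph V)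
    [DecidableRel G.Adj] {k : ℕ} (hΔ : 1 ≤ G.maxDegree) (hk : G.maxDegree < 2 ^ k) {S : Set V}
    (hS : ∀ v ∉ S, k ≤ (G.neighborSet v ∩ S).ncard) :
    ∃ f : {v // v ∉ S} → Finset V, Function.Injective f ∧
      ∀ v, (f v).Nonempty ∧ ∀ w ∈ f v, G.Adj v w ∧ w ∈ S := by
  classical
  let t : {v // v ∉ S} → Finset (Finset V) := fun v =>
    (G.neighborFinset v ∩ S.toFinset).powerset.erase ∅
  have mem_t : ∀ v X, X ∈ t v ↔ X.Nonempty ∧ ∀ w ∈ X, G.Adj v w ∧ w ∈ S := by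
    intro v X
    simp only [t, Finset.mem_erase, Finset.mem_powerset, Finset.subset_iff, Finset.mem_inter,
      SimpleGraph.mem_neighborFinset, Set.mem_toFinset, Finset.nonempty_iff_ne_empty]
  have card_t : ∀ v, G.maxDegree ≤ (t v).card := by
    intro v
    have hv : k ≤ (G.neighborFinset v ∩ S.toFinset).card := by
      have := hS v v.2
      rwa [Set.ncard_eq_toFinset_card', Set.toFinset_inter] at this
    have h2 : 2 ^ k ≤ 2 ^ (G.neighborFinset v ∩ S.toFinset).card :=
      Nat.pow_le_pow_right (by norm_num) hv
    rw [Finset.card_erase_of_mem (Finset.empty_mem_powerset _), Finset.card_powerset]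
    omega
  obtain ⟨f, hf, hft⟩ := (Finset.all_card_le_biUnion_card_iff_exists_injective t).1 (by
    intro A
    refine Nat.le_of_mul_le_mul_right ?_ hΔ
    refine Finset.card_mul_le_card_mul (fun v X => X ∈ t v) ?_ ?_
    · intro v hv
      refine (card_t v).trans (Finset.card_le_card fun X hX => ?_)
      exact Finset.mem_filter.2 ⟨Finset.mem_biUnion.2 ⟨v, hv, hX⟩, hX⟩
    · intro X hX
      obtain ⟨u, -, hu⟩ := Finset.mem_biUnion.1 hX
      obtain ⟨x, hx⟩ := ((mem_t u X).1 hu).1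
      refine le_trans ?_ (G.degree_le_maxDegree x)
      refine Finset.card_le_card_of_injOn Subtype.val ?_ Subtype.val_injective.injOn
      intro v hv
      have hvX := (Finset.mem_filter.1 hv).2
      simpa using (((mem_t v X).1 hvX).2 x hx).1.symm)
  exact ⟨f, hf, fun v => (mem_t v _).1 (hft v)⟩

/-- Prescribed sets `f v ⊆ N(v) ∩ S` are the in-neighbourhoods within `S` of the vertices `v ∉ S`
in some orientation of the graph. -/
theorem exists_isOrientation_inter_eq {V : Type*} (G : SimpleGraph V) {S : Set V}
    (f : {v // v ∉ S} → Finset V) (hf : ∀ v, ∀ w ∈ f v, G.Adj v w ∧ w ∈ S) :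
    ∃ D : V → V → Prop, IsOrientation G D ∧
      ∀ v : {v // v ∉ S}, {w | D w v} ∩ S = f v := by
  classical
  let D : V → V → Prop := fun u v => G.Adj u v ∧
    if hv : v ∉ S then
      if hu : u ∉ S then WellOrderingRel u v else u ∈ f ⟨v, hv⟩
    else
      if hu : u ∉ S then v ∉ f ⟨u, hu⟩ else WellOrderingRel u v
  have asymm : ∀ u v : V, u ≠ v → (WellOrderingRel u v ↔ ¬ WellOrderingRel v u) := by
    intro u v huv
    refine ⟨fun h h' => asymm_of WellOrderingRel h h', fun h => ?_⟩
    rcases trichotomous_of WellOrderingRel u v with h' | h' | h'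
    exacts [h', (huv h').elim, (h h').elim]
  refine ⟨D, ⟨fun u v h => h.1, fun u v h => ?_⟩, fun v => ?_⟩
  · have := asymm u v h.ne
    by_cases hu : u ∈ S <;> by_cases hv : v ∈ S <;> simp [D, h, h.symm, hu, hv, this]
  · ext w
    have := hf v w
    have hv := v.2
    by_cases hw : w ∈ S
    · simp only [D, Set.mem_inter_iff, Set.mem_ofPred_eq, hw, hv, not_true, not_false_eq_true,
        dite_true, dite_false, and_true, Finset.mem_coe]
      exact ⟨fun h => h.2, fun h => ⟨(this h).1.symm, h⟩⟩
    · simp only [Set.mem_inter_iff, hw, and_false, Finset.mem_coe, false_iff]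
      exact fun h => hw (this h).2

/-- if `Δ(G) ≥ 1` and `k ≥ log₂ Δ(G) + 1`, then
`γ⃗_LD(G) ≤ γ_k(G)`. -/
theorem stmt12 {V : Type*} [Fintype V] (G : SimpleGraph V)
    [DecidableRel G.Adj] (k : ℕ) (hΔ : 1 ≤ G.maxDegree) (hkpos : 0 < k)
    (hk : Real.logb 2 (G.maxDegree : ℝ) + 1 ≤ (k : ℝ)) :
    lowerDirLD G ≤ kDomNumber G k := by
  have hlt : G.maxDegree < 2 ^ k := by
    have hpos : (0 : ℝ) < G.maxDegree := by exact_mod_cast hΔ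
    have h : Real.logb 2 (G.maxDegree : ℝ) < k := by linarith
    rw [Real.logb_lt_iff_lt_rpow (by norm_num) hpos, Real.rpow_natCast] at h
    exact_mod_cast h
  obtain ⟨S, hS, hcard⟩ : kDomNumber G k ∈ {m | ∃ S : Set V,
      (∀ v ∉ S, k ≤ (G.neighborSet v ∩ S).ncard) ∧ S.ncard = m} :=
    Nat.sInf_mem ⟨_, Set.univ, fun v hv => (hv (Set.mem_univ v)).elim, rfl⟩
  obtain ⟨f, hinj, hf⟩ := exists_injective_nonempty_subset_neighbors G hΔ hlt hS
  obtain ⟨D, hD, hDf⟩ := exists_isOrientation_inter_eq G f fun v => (hf v).2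
  have hLD : IsDirLDSet D S := by
    refine ⟨fun u hu => ?_, fun u hu v hv huv h => ?_⟩
    · rw [hDf ⟨u, hu⟩]
      exact (hf ⟨u, hu⟩).1
    · rw [hDf ⟨u, hu⟩, hDf ⟨v, hv⟩, Finset.coe_inj] at h
      exact huv (congrArg Subtype.val (hinj h))
  calc lowerDirLD G ≤ gammaLDdir D := Nat.sInf_le ⟨D, hD, rfl⟩
    _ ≤ kDomNumber G k := Nat.sInf_le ⟨S, hLD, hcard⟩
end

section
/- Let G be a graph of order n. Then (1) Γ⃗_LD(G) ≥ α(G), where α(G) is the maximum size of an independent set of G; (2) Γ⃗_LD(G) ≥ ⌈ω(G)/2⌉, where ω(G) is the maximum size of a clique of G; and (3) Γ⃗_LD(G) ≥ 2n/⌈mad(G)/2 + 3⌉, where mad(G) is the maximum over all subgraphs H of G of 2|E(H)|/|V(H)|. -/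
open SimpleGraph

/-- The independence number `α(G)`. -/
noncomputable def indepNumber {V : Type*} (G : SimpleGraph V) : ℕ :=
  sSup {k | ∃ S : Set V, (S.Pairwise fun u v => ¬ G.Adj u v) ∧ S.ncard = k}

/-- The clique number `ω(G)`. -/
noncomputable def cliqueNumber {V : Type*} (G : SimpleGraph V) : ℕ :=
  sSup {k | ∃ S : Set V, S.Pairwise G.Adj ∧ S.ncard = k}

/-- The maximum average degree `mad(G)`: the maximum over all subgraphs `H`
of `G` (with at least one vertex) of `2 |E(H)| / |V(H)|`. -/
noncomputable def mad {V : Type*} (G : SimpleGraph V) : ℝ :=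
  sSup {x : ℝ | ∃ H : G.Subgraph, H.verts.Nonempty ∧
    x = 2 * (H.edgeSet.ncard : ℝ) / (H.verts.ncard : ℝ)}

theorem gammaLDdir_le_card {V : Type*} [Fintype V] (D : V → V → Prop) :
    gammaLDdir D ≤ Fintype.card V := by
  refine Nat.sInf_le ⟨Set.univ, ⟨fun u hu => (hu (Set.mem_univ u)).elim,
    fun u hu => (hu (Set.mem_univ u)).elim⟩, ?_⟩
  rw [Set.ncard_univ, Nat.card_eq_fintype_card]

theorem exists_isDirLDSet_ncard_le_upperDirLD {V : Type*} [Fintype V] {G : SimpleGraph V}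
    {D : V → V → Prop} (hD : IsOrientation G D) :
    ∃ S : Set V, IsDirLDSet D S ∧ S.ncard ≤ upperDirLD G := by
  have hne : {n | ∃ S : Set V, IsDirLDSet D S ∧ S.ncard = n}.Nonempty :=
    ⟨_, Set.univ, ⟨fun u hu => (hu (Set.mem_univ u)).elim,
      fun u hu => (hu (Set.mem_univ u)).elim⟩, rfl⟩
  obtain ⟨S, hS, hcard⟩ := Nat.sInf_mem hne
  refine ⟨S, hS, hcard.trans_le (le_csSup ⟨Fintype.card V, ?_⟩ ⟨D, hD, rfl⟩)⟩
  rintro _ ⟨D', -, rfl⟩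
  exact gammaLDdir_le_card D'

/-- Orienting every edge along an injective ranking gives an orientation. -/
theorem isOrientation_of_injective {V : Type*} (G : SimpleGraph V) {r : V → ℕ}
    (hr : Function.Injective r) : IsOrientation G fun u v => G.Adj u v ∧ r u < r v := by
  refine ⟨fun u v h => h.1, fun u v h => ?_⟩
  have := hr.ne h.ne
  simp only [h, h.symm, true_and]
  omega

/-- Any set of vertices is an initial segment of some injective ranking. -/
theorem exists_injective_rank {V : Type*} [Fintype V] (K : Set V) :
    ∃ r : V → ℕ, Function.Injective r ∧ ∀ u ∈ K, ∀ w, r w < r u → w ∈ K := by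
  classical
  let e := Fintype.equivFin V
  refine ⟨fun u => (e u : ℕ) + if u ∈ K then 0 else Fintype.card V, fun u v h => ?_,
    fun u hu w h => ?_⟩
  · have := (e u).isLt
    have := (e v).isLt
    apply e.injective
    ext
    dsimp only at h
    split_ifs at h <;> omega
  · by_contra hw
    have := (e u).isLt
    simp only [hu, hw, if_true, if_false] at h
    omega

theorem ncard_le_upperDirLD_of_indep {V : Type*} [Fintype V] (G : SimpleGraph V) {I : Set V}
    (hI : I.Pairwise fun u v => ¬ G.Adj u v) : I.ncard ≤ upperDirLD G := by
  obtain ⟨r, hr, hfirst⟩ := exists_injective_rank I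
  obtain ⟨S, hS, hcard⟩ :=
    exists_isDirLDSet_ncard_le_upperDirLD (isOrientation_of_injective G hr)
  refine (Set.ncard_le_ncard (fun u hu => ?_) S.toFinite).trans hcard
  by_contra huS
  obtain ⟨w, ⟨hadj, hlt⟩, -⟩ := hS.1 u huS
  exact hI (hfirst u hu w hlt) hu hadj.ne hadj

theorem ncard_le_two_mul_upperDirLD_of_clique {V : Type*} [Fintype V] (G : SimpleGraph V)
    {K : Set V} (hK : K.Pairwise G.Adj) : K.ncard ≤ 2 * upperDirLD G := by
  obtain ⟨r, hr, hfirst⟩ := exists_injective_rank K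
  obtain ⟨S, hS, hcard⟩ :=
    exists_isDirLDSet_ncard_le_upperDirLD (isOrientation_of_injective G hr)
  let inS : V → Set V := fun u => {w | G.Adj w u ∧ r w < r u} ∩ S
  have hmono : ∀ u ∈ K, ∀ v ∈ K, r u ≤ r v → inS u ⊆ inS v := by
    rintro u hu v hv huv w ⟨⟨-, hlt⟩, hwS⟩
    have hlt' : r w < r v := hlt.trans_le huv
    exact ⟨⟨hK (hfirst u hu w hlt) hv fun h => hlt'.ne (congrArg r h), hlt'⟩, hwS⟩
  have hinj : Set.InjOn (fun u => (inS u).ncard) (K \ S) := by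
    rintro u ⟨hu, huS⟩ v ⟨hv, hvS⟩ h
    by_contra hne
    apply hS.2 u huS v hvS hne
    rcases le_total (r u) (r v) with hle | hle
    · exact Set.eq_of_subset_of_ncard_le (hmono u hu v hv hle) h.ge (Set.toFinite _)
    · exact (Set.eq_of_subset_of_ncard_le (hmono v hv u hu hle) h.le (Set.toFinite _)).symm
  have hdiff : (K \ S).ncard ≤ (Set.Icc 1 S.ncard).ncard := by
    refine Set.ncard_le_ncard_of_injOn _ (fun u hu => ⟨?_, ?_⟩) hinj (Set.finite_Icc _ _)
    · exact (Set.ncard_pos (Set.toFinite _)).2 (hS.1 u hu.2)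
    · exact Set.ncard_le_ncard Set.inter_subset_right S.toFinite
  have hIcc : (Set.Icc 1 S.ncard).ncard = S.ncard := by
    rw [← Finset.coe_Icc, Set.ncard_coe_finset, Nat.card_Icc, Nat.add_sub_cancel]
  have hsum := Set.ncard_le_ncard_sdiff_add_ncard K S S.toFinite
  omega

/-- A locating-dominating set of a digraph with maximum out-degree at most `d` has size at least
`2 n / (d + 3)`. -/
theorem IsDirLDSet.two_mul_card_le {V : Type*} [Fintype V] {D : V → V → Prop} {S : Set V}
    (hS : IsDirLDSet D S) {d : ℕ} (hd : ∀ u, {v | D u v}.ncard ≤ d) :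
    2 * Fintype.card V ≤ (d + 3) * S.ncard := by
  classical
  let s : Finset V := S.toFinset
  have hs : S.ncard = s.card := Set.ncard_eq_toFinset_card' S
  let inS : V → Finset V := fun u => s.filter fun w => D w u
  have hcoe : ∀ u, ((inS u : Finset V) : Set V) = {w | D w u} ∩ S := by
    intro u
    ext w
    simp [inS, s, and_comm]
  have hmem : ∀ u ∈ sᶜ, u ∉ S := fun u hu => by simpa [s] using hu
  have hone : ((sᶜ).filter fun u => (inS u).card = 1).card ≤ s.card := by
    rw [← Nat.choose_one_right s.card, ← Finset.card_powersetCard]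
    refine Finset.card_le_card_of_injOn inS (fun u hu => ?_) fun u hu v hv h => ?_
    · exact Finset.mem_coe.2 (Finset.mem_powersetCard.2
        ⟨Finset.filter_subset _ _, (Finset.mem_filter.1 hu).2⟩)
    · by_contra hne
      refine hS.2 u (hmem u (Finset.mem_filter.1 hu).1) v (hmem v (Finset.mem_filter.1 hv).1) hne ?_
      rw [← hcoe, ← hcoe, h]
  have hlower : sᶜ.card * 2 ≤
      ∑ u ∈ sᶜ, (inS u).card + ((sᶜ).filter fun u => (inS u).card = 1).card := by
    rw [Finset.card_filter, ← Finset.sum_add_distrib, ← smul_eq_mul]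
    refine Finset.card_nsmul_le_sum _ _ _ fun u hu => ?_
    have hpos : 0 < (inS u).card := by
      rw [Finset.card_pos, ← Finset.coe_nonempty, hcoe]
      exact hS.1 u (hmem u hu)
    split_ifs <;> omega
  have hupper : ∑ u ∈ sᶜ, (inS u).card ≤ s.card * d := by
    have hswap := Finset.sum_card_bipartiteAbove_eq_sum_card_bipartiteBelow
      (s := s) (t := sᶜ) D
    change ∑ u ∈ sᶜ, (Finset.bipartiteBelow D s u).card ≤ _
    rw [← hswap, ← smul_eq_mul]
    refine Finset.sum_le_card_nsmul _ _ _ fun w _ => le_trans ?_ (hd w)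
    rw [← Set.ncard_coe_finset]
    refine Set.ncard_le_ncard (fun v hv => ?_) (Set.toFinite _)
    exact (Finset.mem_filter.1 hv).2
  have hcompl := Finset.card_add_card_compl s
  rw [hs]
  nlinarith

/-- Hakimi's theorem: if every subgraph has at most `d` times as many edges as vertices, then `G` has
an orientation with maximum out-degree at most `d`. -/
theorem exists_isOrientation_outDegree_le {V : Type*} [Fintype V] (G : SimpleGraph V) {d : ℕ}
    (h : ∀ H : G.Subgraph, H.edgeSet.ncard ≤ d * H.verts.ncard) :
    ∃ D : V → V → Prop, IsOrientation G D ∧ ∀ u, {v | D u v}.ncard ≤ d := by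
  classical
  let t : G.edgeSet → Finset (V × Fin d) := fun e => (e : Sym2 V).toFinset ×ˢ Finset.univ
  have hall : ∀ F : Finset G.edgeSet, F.card ≤ (F.biUnion t).card := by
    intro F
    let W : Finset V := F.biUnion fun e => (e : Sym2 V).toFinset
    let H : G.Subgraph :=
      { verts := W
        Adj := fun u v => ∃ e ∈ F, (e : Sym2 V) = s(u, v)
        adj_sub := by
          rintro u v ⟨e, -, he⟩
          rw [← SimpleGraph.mem_edgeSet, ← he]
          exact e.2
        edge_vert := by
          rintro u v ⟨e, heF, he⟩
          refine Finset.mem_coe.2 (Finset.mem_biUnion.2 ⟨e, heF, ?_⟩)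
          simp [he]
        symm := ⟨by
          rintro u v ⟨e, heF, he⟩
          exact ⟨e, heF, he.trans Sym2.eq_swap⟩⟩ }
    have hedge : H.edgeSet = ((F.map (Function.Embedding.subtype _) : Finset (Sym2 V)) :
        Set (Sym2 V)) := by
      ext e
      induction e with
      | _ u v =>
        rw [SimpleGraph.Subgraph.mem_edgeSet]
        simp [H]
    have hunion : F.biUnion t = W ×ˢ Finset.univ := by
      ext x
      simp [t, W]
    have hH := h H
    rw [hedge, Set.ncard_coe_finset, Finset.card_map, Set.ncard_coe_finset] at hH
    rw [hunion, Finset.card_product, Finset.card_univ, Fintype.card_fin, mul_comm]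
    exact hH
  obtain ⟨f, hf, hft⟩ := (Finset.all_card_le_biUnion_card_iff_exists_injective t).1 hall
  have htail : ∀ u v (huv : G.Adj u v),
      (f ⟨s(u, v), huv⟩).1 = u ∨ (f ⟨s(u, v), huv⟩).1 = v := by
    intro u v huv
    simpa [t] using hft ⟨s(u, v), huv⟩
  have hswap : ∀ u v (huv : G.Adj u v), f ⟨s(v, u), huv.symm⟩ = f ⟨s(u, v), huv⟩ :=
    fun u v huv => congrArg f (Subtype.ext Sym2.eq_swap)
  refine ⟨fun u v => ∃ huv : G.Adj u v, (f ⟨s(u, v), huv⟩).1 = u,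
    ⟨fun u v h => h.1, fun u v huv => ⟨?_, fun hn => ?_⟩⟩, fun u => ?_⟩
  · rintro ⟨_, hu⟩ ⟨_, hv⟩
    rw [hswap u v huv] at hv
    exact huv.ne (hu.symm.trans hv)
  · refine ⟨huv, (htail u v huv).resolve_right fun hv => hn ⟨huv.symm, ?_⟩⟩
    exact (congrArg Prod.fst (hswap u v huv)).trans hv
  · rw [← Nat.card_coe_set_eq]
    refine (Nat.card_le_card_of_injective
      (fun v : {v | ∃ huv : G.Adj u v, (f ⟨s(u, v), huv⟩).1 = u} =>
        (f ⟨s(u, v), v.2.1⟩).2) fun v w hvw => ?_).trans_eq (Nat.card_fin d)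
    have hfvw := hf (Prod.ext (v.2.2.trans w.2.2.symm) hvw)
    exact Subtype.ext (Sym2.congr_right.1 (congrArg Subtype.val hfvw))

theorem edgeSet_ncard_le_mad {V : Type*} [Fintype V] {G : SimpleGraph V}
    (H : G.Subgraph) : (H.edgeSet.ncard : ℝ) ≤ mad G / 2 * H.verts.ncard := by
  rcases H.verts.eq_empty_or_nonempty with hH | hH
  · have hbot : H = ⊥ := H.eq_bot_iff_verts_eq_empty.2 hH
    simp [hbot]
  · have hpos : (0 : ℝ) < H.verts.ncard := by
      exact_mod_cast (Set.ncard_pos H.verts.toFinite).2 hH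
    have hfin : {x : ℝ | ∃ H : G.Subgraph, H.verts.Nonempty ∧
        x = 2 * (H.edgeSet.ncard : ℝ) / (H.verts.ncard : ℝ)}.Finite := by
      refine (Set.finite_range fun H : G.Subgraph =>
        2 * (H.edgeSet.ncard : ℝ) / (H.verts.ncard : ℝ)).subset ?_
      rintro _ ⟨H', -, rfl⟩
      exact ⟨H', rfl⟩
    have hle : 2 * (H.edgeSet.ncard : ℝ) / (H.verts.ncard : ℝ) ≤ mad G :=
      le_csSup hfin.bddAbove ⟨H, hH, rfl⟩
    rw [div_le_iff₀ hpos] at hle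
    linarith

theorem mad_nonneg {V : Type*} (G : SimpleGraph V) : 0 ≤ mad G := by
  refine Real.sSup_nonneg ?_
  rintro _ ⟨H, -, rfl⟩
  positivity

/-- `Γ⃗_LD(G) ≥ α(G)`, `Γ⃗_LD(G) ≥ ⌈ω(G)/2⌉` and
`Γ⃗_LD(G) ≥ 2n / ⌈mad(G)/2 + 3⌉`. -/
theorem stmt14 {V : Type*} [Fintype V] (G : SimpleGraph V) :
    indepNumber G ≤ upperDirLD G ∧
    (cliqueNumber G + 1) / 2 ≤ upperDirLD G ∧
    (2 * (Fintype.card V : ℝ)) / ((⌈mad G / 2 + 3⌉₊ : ℕ) : ℝ)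
      ≤ (upperDirLD G : ℝ) := by
  refine ⟨csSup_le' ?_, ?_, ?_⟩
  · rintro _ ⟨I, hI, rfl⟩
    exact ncard_le_upperDirLD_of_indep G hI
  · have hω : cliqueNumber G ≤ 2 * upperDirLD G := by
      refine csSup_le' ?_
      rintro _ ⟨K, hK, rfl⟩
      exact ncard_le_two_mul_upperDirLD_of_clique G hK
    omega
  · have hceil : ⌈mad G / 2 + 3⌉₊ = ⌈mad G / 2⌉₊ + 3 := by
      exact_mod_cast Nat.ceil_add_natCast (div_nonneg (mad_nonneg G) zero_le_two) 3
    obtain ⟨D, hD, hout⟩ := exists_isOrientation_outDegree_le G (d := ⌈mad G / 2⌉₊) fun H => by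
      have hle : (H.edgeSet.ncard : ℝ) ≤ (⌈mad G / 2⌉₊ : ℝ) * H.verts.ncard :=
        (edgeSet_ncard_le_mad H).trans
          (mul_le_mul_of_nonneg_right (Nat.le_ceil _) (Nat.cast_nonneg _))
      exact_mod_cast hle
    obtain ⟨S, hS, hcard⟩ := exists_isDirLDSet_ncard_le_upperDirLD hD
    have hmain := (hS.two_mul_card_le hout).trans (Nat.mul_le_mul_left _ hcard)
    rw [hceil, div_le_iff₀ (by positivity), mul_comm (upperDirLD G : ℝ)]
    exact_mod_cast hmain
end
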